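/- arXiv:1901.06425 — 6 statements merged into one kernel-verified Lean document; each statement's English description precedes it below -/
import Mathlib

section
/- Let G be a finite group. If β(G) ≤ 5/|G| (equivalently, if G has at most 5 subgroups), then G is abelian. -/
noncomputable def beta (G : Type*) [Group G] : ℝ :=
  (Nat.card (Subgroup G) : ℝ) / (Nat.card G : ℝ)

open Subgroup in
/-- Two generators of the same cyclic subgroup commute. -/
theorem commute_of_zpowers_eq {G : Type*} [Group G] {x y : G}
    (h : zpowers x = zpowers y) : Commute x y := by
  obtain ⟨n, rfl⟩ := mem_zpowers_iff.mp (h ▸ mem_zpowers x : x ∈ zpowers y)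
  exact (Commute.refl y).zpow_left n

open Subgroup in
theorem zpowers_ne_top_of_not_commute {G : Type*} [Group G] {a b : G}
    (hab : ¬ Commute a b) (x : G) : zpowers x ≠ ⊤ := by
  intro h
  obtain ⟨m, rfl⟩ := mem_zpowers_iff.mp (h ▸ mem_top a : a ∈ zpowers x)
  obtain ⟨n, rfl⟩ := mem_zpowers_iff.mp (h ▸ mem_top b : b ∈ zpowers x)
  exact hab (Commute.zpow_zpow_self x m n)

theorem not_commute_mul_right {G : Type*} [Group G] {a b : G} (hab : ¬ Commute a b) :
    ¬ Commute a (a * b) := fun h =>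
  hab (by simpa using (Commute.refl a).inv_right.mul_right h)

theorem not_commute_right_mul {G : Type*} [Group G] {a b : G} (hab : ¬ Commute a b) :
    ¬ Commute b (a * b) := fun h =>
  hab (by simpa using (h.mul_right (Commute.refl b).inv_right).symm)

open Subgroup in
/-- If two elements `a`, `b` of a group with at most five subgroups do not commute, then
the subgroups are the two trivial ones and those generated by `a`, `b` and `a * b`. -/
theorem subgroup_eq_of_not_commute {G : Type*} [Group G] [Finite G]
    (hcard : Nat.card (Subgroup G) ≤ 5) {a b : G} (hab : ¬ Commute a b) (H : Subgroup G) :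
    H = ⊥ ∨ H = ⊤ ∨ H = zpowers a ∨ H = zpowers b ∨ H = zpowers (a * b) := by
  classical
  have := Fintype.ofFinite (Subgroup G)
  rw [Nat.card_eq_fintype_card] at hcard
  have ha : ⊥ ≠ zpowers a := fun h => hab (by simp [zpowers_eq_bot.mp h.symm])
  have hb : ⊥ ≠ zpowers b := fun h => hab (by simp [zpowers_eq_bot.mp h.symm])
  have hm : ⊥ ≠ zpowers (a * b) := fun h =>
    not_commute_mul_right hab (by simp [zpowers_eq_bot.mp h.symm])
  have ht : (⊥ : Subgroup G) ≠ ⊤ := fun h =>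
    zpowers_ne_top_of_not_commute hab 1 (by simpa using h)
  have hne (x : G) := (zpowers_ne_top_of_not_commute hab x).symm
  have h₁ : zpowers a ≠ zpowers b := fun h => hab (commute_of_zpowers_eq h)
  have h₂ : zpowers a ≠ zpowers (a * b) := fun h =>
    not_commute_mul_right hab (commute_of_zpowers_eq h)
  have h₃ : zpowers b ≠ zpowers (a * b) := fun h =>
    not_commute_right_mul hab (commute_of_zpowers_eq h)
  have hs : ({⊥, ⊤, zpowers a, zpowers b, zpowers (a * b)} : Finset (Subgroup G)).card = 5 := by
    simp [Finset.card_insert_of_notMem, ha, hb, hm, ht, hne, h₁, h₂, h₃]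
  have hu := Finset.eq_univ_of_card _
    (le_antisymm (Finset.card_le_univ _) (hs.symm ▸ hcard))
  have hH := Finset.mem_univ H
  rw [← hu] at hH
  simpa using hH

open Subgroup in
theorem commute_sq_of_card_subgroup_le {G : Type*} [Group G] [Finite G]
    (hcard : Nat.card (Subgroup G) ≤ 5) (a b : G) : Commute a (b ^ 2) := by
  by_cases hab : Commute a b
  · exact hab.pow_right 2
  have hab' : ¬ Commute a b⁻¹ := by simpa using hab
  rcases subgroup_eq_of_not_commute hcard hab (zpowers (a * b⁻¹)) with h | h | h | h | h
  · exact absurd (by simp [zpowers_eq_bot.mp h]) (not_commute_mul_right hab')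
  · exact absurd h (zpowers_ne_top_of_not_commute hab _)
  · exact absurd (commute_of_zpowers_eq h).symm (not_commute_mul_right hab')
  · exact absurd (commute_of_zpowers_eq h).symm.inv_left (not_commute_right_mul hab')
  · have hc : a * b⁻¹ * (a * b) = a * b * (a * b⁻¹) := commute_of_zpowers_eq h
    have hc' : b⁻¹ * a * b = b * a * b⁻¹ := by
      simpa only [mul_assoc, mul_right_inj] using hc
    calc a * b ^ 2 = b * (b⁻¹ * a * b) * b := by simp [sq, mul_assoc]
      _ = b ^ 2 * a := by rw [hc']; simp [sq, mul_assoc]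

open Subgroup in
theorem commute_of_card_subgroup_le {G : Type*} [Group G] [Finite G]
    (hcard : Nat.card (Subgroup G) ≤ 5) (a b : G) : Commute a b := by
  by_contra hab
  have not_central {x y : G} (hxy : ¬ Commute x y) : center G ≠ zpowers x := fun h =>
    hxy (mem_center_iff.mp (h ▸ mem_zpowers x : x ∈ center G) y).symm
  rcases subgroup_eq_of_not_commute hcard hab (center G) with h | h | h | h | h
  · have hsq (x : G) : x ^ 2 = 1 := by
      rw [← mem_bot, ← h, mem_center_iff]
      exact fun g => commute_sq_of_card_subgroup_le hcard g x
    exact hab (Commute.of_orderOf_dvd_two (fun x => orderOf_dvd_of_pow_eq_one (hsq x)) a b)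
  · exact hab (mem_center_iff.mp (h ▸ mem_top b : b ∈ center G) a)
  · exact not_central hab h
  · exact not_central (fun hba => hab hba.symm) h
  · exact not_central (fun hc => not_commute_mul_right hab hc.symm) h

theorem stmt_1 (G : Type*) [Group G] [Finite G]
    (h : beta G ≤ 5 / (Nat.card G : ℝ)) :
    ∀ a b : G, a * b = b * a := by
  have hpos : (0 : ℝ) < Nat.card G := by exact_mod_cast Nat.card_pos
  have hcard : Nat.card (Subgroup G) ≤ 5 := by
    exact_mod_cast (div_le_div_iff_of_pos_right hpos).mp h
  exact commute_of_card_subgroup_le hcard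
end

section
/- Let p be a prime, n ≥ 3 an integer, and G an abelian group of order p^n that is not cyclic. Then β(G) ≥ β(Z_p × Z_{p^{n-1}}) = ((n-1)(p+1)+2)/p^n, and equality holds if and only if G is isomorphic to Z_p × Z_{p^{n-1}}. -/
namespace SubgroupCount

variable {A B G : Type}

section Step

variable [CommGroup A] [CommGroup B]

/-- The projection `A × B → (A ⧸ N) × B`. -/
def quotientProd (N : Subgroup A) : A × B →* (A ⧸ N) × B :=
  (QuotientGroup.mk' N).prodMap (MonoidHom.id B)

lemma quotientProd_surjective (N : Subgroup A) :
    Function.Surjective (quotientProd (B := B) N) :=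
  Function.Surjective.prodMap (QuotientGroup.mk'_surjective N) Function.surjective_id

lemma ker_quotientProd (N : Subgroup A) :
    (quotientProd (B := B) N).ker = N.prod ⊥ := by
  ext ⟨a, b⟩
  simp [quotientProd, MonoidHom.mem_ker, Subgroup.mem_prod]

/-- Subgroups of `A × B` containing `N × 1`, together with the trivial subgroup and the cyclic
subgroups generated by `(y, b)` for `y ∈ N`. -/
def subgroupOfParts (N : Subgroup A) (b : B) :
    Subgroup ((A ⧸ N) × B) ⊕ Option N → Subgroup (A × B)
  | .inl K => K.comap (quotientProd N)
  | .inr none => ⊥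
  | .inr (some y) => Subgroup.zpowers ((y : A), b)

lemma prod_bot_le_subgroupOfParts_inl (N : Subgroup A) (b : B) (K : Subgroup ((A ⧸ N) × B)) :
    N.prod ⊥ ≤ subgroupOfParts N b (.inl K) := by
  rw [← ker_quotientProd]
  exact Subgroup.ker_le_comap _ K

variable {p : ℕ} {N : Subgroup A} {b : B}

lemma eq_one_of_mem_zpowers (hN : Nat.card N = p) (hb : orderOf b = p) (y : N) {x : A}
    (hx : (x, (1 : B)) ∈ Subgroup.zpowers ((y : A), b)) : x = 1 := by
  obtain ⟨k, hk⟩ := Subgroup.mem_zpowers_iff.mp hx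
  simp only [Prod.pow_mk, Prod.mk.injEq] at hk
  have hdvd : (p : ℤ) ∣ k := by
    rw [← hb]
    exact orderOf_dvd_iff_zpow_eq_one.mpr hk.2
  have hy : orderOf (y : A) ∣ p := by
    rw [Subgroup.orderOf_coe, ← hN]
    exact orderOf_dvd_natCard y
  rw [← hk.1]
  exact orderOf_dvd_iff_zpow_eq_one.mp ((Int.natCast_dvd_natCast.mpr hy).trans hdvd)

lemma natCard_parts [Finite A] [Finite B] (hN : Nat.card N = p) :
    Nat.card (Subgroup ((A ⧸ N) × B) ⊕ Option N) =
      Nat.card (Subgroup ((A ⧸ N) × B)) + (p + 1) := by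
  rw [Nat.card_sum, Finite.card_option, hN]

variable [hp : Fact p.Prime]

lemma not_prod_bot_le_subgroupOfParts_inr (hN : Nat.card N = p) (hb : orderOf b = p)
    (o : Option N) : ¬ N.prod ⊥ ≤ subgroupOfParts N b (.inr o) := by
  intro h
  have hbot : N = ⊥ := by
    rw [Subgroup.eq_bot_iff_forall]
    intro x hx
    have hmem := h (show (x, (1 : B)) ∈ N.prod ⊥ from ⟨hx, Subgroup.mem_bot.mpr rfl⟩)
    cases o with
    | none => simpa [subgroupOfParts] using hmem
    | some y => exact eq_one_of_mem_zpowers hN hb y hmem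
  rw [hbot, Subgroup.card_bot] at hN
  exact hp.out.one_lt.ne hN

lemma subgroupOfParts_injective (hN : Nat.card N = p) (hb : orderOf b = p) :
    Function.Injective (subgroupOfParts N b) := by
  have hb1 : b ≠ 1 := by
    rintro rfl
    rw [orderOf_one] at hb
    exact hp.out.one_lt.ne hb
  rintro (K | o) (K' | o') h
  · exact congrArg _ (Subgroup.comap_injective (quotientProd_surjective N) h)
  · exact absurd (h ▸ prod_bot_le_subgroupOfParts_inl N b K)
      (not_prod_bot_le_subgroupOfParts_inr hN hb o')
  · exact absurd (h ▸ prod_bot_le_subgroupOfParts_inl N b K')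
      (not_prod_bot_le_subgroupOfParts_inr hN hb o)
  · rcases o with _ | y <;> rcases o' with _ | y'
    · rfl
    · exact absurd (congrArg Prod.snd (Subgroup.zpowers_eq_bot.mp h.symm)) hb1
    · exact absurd (congrArg Prod.snd (Subgroup.zpowers_eq_bot.mp h)) hb1
    · have h1 : ((y : A), b) ∈ Subgroup.zpowers ((y' : A), b) := by
        change Subgroup.zpowers _ = Subgroup.zpowers _ at h
        rw [← h]
        exact Subgroup.mem_zpowers _
      have h2 := div_mem h1 (Subgroup.mem_zpowers ((y' : A), b))
      rw [Prod.mk_div_mk, div_self'] at h2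
      have h3 := div_eq_one.mp (eq_one_of_mem_zpowers hN hb y' h2)
      rw [Subtype.ext h3]

variable [Finite A]

lemma mem_of_pow_eq_one [IsCyclic A] (hN : Nat.card N = p) {x : A} (hx : x ^ p = 1) : x ∈ N := by
  have hle : N ≤ (powMonoidHom p : A →* A).ker := by
    intro y hy
    have := pow_card_eq_one' (x := (⟨y, hy⟩ : N))
    rw [hN] at this
    exact congrArg Subtype.val this
  have hcard : Nat.card (powMonoidHom p : A →* A).ker ≤ Nat.card N := by
    rw [IsCyclic.card_powMonoidHom_ker, hN]
    exact Nat.gcd_le_right _ hp.out.pos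
  rw [Subgroup.eq_of_le_of_card_ge hle hcard]
  exact hx

lemma eq_one_of_mem_of_not_prod_bot_le [IsCyclic A] {m : ℕ} (hA : Nat.card A = p ^ m)
    (hN : Nat.card N = p) {H : Subgroup (A × B)} (hNH : ¬ N.prod ⊥ ≤ H) {x : A}
    (hx : (x, (1 : B)) ∈ H) : x = 1 := by
  by_contra hx1
  have hdvd : p ∣ Nat.card (Subgroup.zpowers x) := by
    obtain ⟨k, -, hk⟩ := (Nat.dvd_prime_pow hp.out).mp
      (hA ▸ Subgroup.card_subgroup_dvd_card (Subgroup.zpowers x))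
    rw [hk]
    refine dvd_pow_self p ?_
    rintro rfl
    rw [pow_zero, Nat.card_zpowers, orderOf_eq_one_iff] at hk
    exact hx1 hk
  obtain ⟨⟨z, hz⟩, hzp⟩ := exists_prime_orderOf_dvd_card' p hdvd
  rw [Subgroup.orderOf_mk] at hzp
  have hzN : z ∈ N := mem_of_pow_eq_one hN (hzp ▸ pow_orderOf_eq_one z)
  have hzpow : Subgroup.zpowers z = N := by
    refine Subgroup.eq_of_le_of_card_ge (Subgroup.zpowers_le.mpr hzN) ?_
    rw [Nat.card_zpowers, hzp, hN]
  refine hNH ?_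
  have hNx : N ≤ Subgroup.zpowers x := hzpow ▸ Subgroup.zpowers_le.mpr hz
  rintro ⟨u, v⟩ ⟨hu, hv⟩
  obtain ⟨k, rfl⟩ := Subgroup.mem_zpowers_iff.mp (hNx hu)
  obtain rfl : v = 1 := hv
  simpa using zpow_mem hx k

lemma subgroupOfParts_surjective [IsCyclic A] {m : ℕ} (hA : Nat.card A = p ^ m)
    (hB : Nat.card B = p) (hN : Nat.card N = p) (hb : orderOf b = p) :
    Function.Surjective (subgroupOfParts N b) := by
  intro H
  by_cases hNH : N.prod ⊥ ≤ H
  · refine ⟨.inl (H.map (quotientProd N)), ?_⟩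
    rw [← ker_quotientProd] at hNH
    exact Subgroup.comap_map_eq_self hNH
  have hone : ∀ {x : A}, (x, (1 : B)) ∈ H → x = 1 :=
    fun hx => eq_one_of_mem_of_not_prod_bot_le hA hN hNH hx
  by_cases hH : H = ⊥
  · exact ⟨.inr none, hH.symm⟩
  obtain ⟨⟨y, c⟩, hyc, hne⟩ := H.bot_or_exists_ne_one.resolve_left hH
  have hc : c ≠ 1 := by
    rintro rfl
    exact hne (by rw [hone hyc]; rfl)
  obtain ⟨k, rfl⟩ := Subgroup.mem_zpowers_iff.mp (mem_zpowers_of_prime_card hB hc (g' := b))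
  have hmem : (y ^ k, c ^ k) ∈ H := zpow_mem hyc k
  have hyp : (y ^ k) ^ p = 1 := by
    refine hone ?_
    have := pow_mem hmem p
    rwa [Prod.pow_mk, ← hb, pow_orderOf_eq_one (c ^ k), hb] at this
  have hck : c ^ k ≠ 1 := by
    intro h
    rw [h, orderOf_one] at hb
    exact hp.out.one_lt.ne hb
  refine ⟨.inr (some ⟨y ^ k, mem_of_pow_eq_one hN hyp⟩), le_antisymm ?_ ?_⟩
  · exact Subgroup.zpowers_le.mpr hmem
  · rintro ⟨u, v⟩ huv
    obtain ⟨j, rfl⟩ := Subgroup.mem_zpowers_iff.mp (mem_zpowers_of_prime_card hB hck (g' := v))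
    have h := div_mem huv (zpow_mem hmem j)
    rw [Prod.pow_mk, Prod.mk_div_mk, div_self'] at h
    exact Subgroup.mem_zpowers_iff.mpr ⟨j, by rw [div_eq_one.mp (hone h)]; rfl⟩

variable [Finite B]

lemma card_quotient_add_le (hN : Nat.card N = p) (hb : orderOf b = p) :
    Nat.card (Subgroup ((A ⧸ N) × B)) + (p + 1) ≤ Nat.card (Subgroup (A × B)) := by
  rw [← natCard_parts hN]
  exact Nat.card_le_card_of_injective _ (subgroupOfParts_injective hN hb)

lemma card_quotient_add_lt (hN : Nat.card N = p) (hb : orderOf b = p) (H : Subgroup (A × B))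
    (hNH : ¬ N.prod ⊥ ≤ H) (hH : p < Nat.card H) :
    Nat.card (Subgroup ((A ⧸ N) × B)) + (p + 1) < Nat.card (Subgroup (A × B)) := by
  rw [← natCard_parts hN]
  refine lt_of_le_of_ne
    (Nat.card_le_card_of_injective _ (subgroupOfParts_injective hN hb)) fun heq => ?_
  obtain ⟨x, hx⟩ := (Nat.bijective_iff_injective_and_card (subgroupOfParts N b)).mpr
    ⟨subgroupOfParts_injective hN hb, heq⟩ |>.surjective H
  revert x
  rintro (K | _ | y) rfl
  · exact hNH (prod_bot_le_subgroupOfParts_inl N b K)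
  · simp only [subgroupOfParts, Subgroup.card_bot] at hH
    exact hH.not_gt hp.out.one_lt
  · have hy : orderOf (y : A) ∣ p := by
      rw [Subgroup.orderOf_coe, ← hN]
      exact orderOf_dvd_natCard y
    simp only [subgroupOfParts, Nat.card_zpowers, Prod.orderOf_mk, hb] at hH
    exact hH.not_ge (Nat.le_of_dvd hp.out.pos (Nat.lcm_dvd hy dvd_rfl))

lemma card_quotient_add_eq [IsCyclic A] {m : ℕ} (hA : Nat.card A = p ^ m)
    (hB : Nat.card B = p) (hN : Nat.card N = p) (hb : orderOf b = p) :
    Nat.card (Subgroup (A × B)) = Nat.card (Subgroup ((A ⧸ N) × B)) + (p + 1) := by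
  rw [← natCard_parts hN]
  exact (Nat.card_eq_of_bijective _
    ⟨subgroupOfParts_injective hN hb, subgroupOfParts_surjective hA hB hN hb⟩).symm

end Step

lemma card_subgroup_congr {G' : Type} [Group G] [Group G'] (e : G ≃* G') :
    Nat.card (Subgroup G) = Nat.card (Subgroup G') :=
  Nat.card_congr e.mapSubgroup.toEquiv

variable {p : ℕ} [hp : Fact p.Prime]

lemma exists_orderOf_eq_of_card [Group B] [Finite B] {k : ℕ}
    (hB : Nat.card B = p ^ (k + 1)) : ∃ b : B, orderOf b = p :=
  exists_prime_orderOf_dvd_card' p (hB ▸ dvd_pow_self p k.succ_ne_zero)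

lemma exists_subgroup_card_eq [Group A] [Finite A] {k : ℕ}
    (hA : Nat.card A = p ^ (k + 1)) : ∃ N : Subgroup A, Nat.card N = p := by
  obtain ⟨a, ha⟩ := exists_orderOf_eq_of_card hA
  exact ⟨Subgroup.zpowers a, by rw [Nat.card_zpowers, ha]⟩

lemma card_quotient_of_card [Group A] [Finite A] {k : ℕ} (hA : Nat.card A = p ^ (k + 1))
    {N : Subgroup A} (hN : Nat.card N = p) : Nat.card (A ⧸ N) = p ^ k := by
  have h := N.card_eq_card_quotient_mul_card_subgroup
  rw [hA, hN, pow_succ] at h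
  exact (Nat.eq_of_mul_eq_mul_right hp.out.pos h).symm

lemma le_card_subgroup_prod_of_card_eq_prime [CommGroup A] [Finite A] [CommGroup B] [Finite B]
    {a : ℕ} (hA : Nat.card A = p ^ a) (hB : Nat.card B = p) :
    a * (p + 1) + 2 ≤ Nat.card (Subgroup (A × B)) := by
  induction a generalizing A with
  | zero =>
    have : Nontrivial B := Finite.one_lt_card_iff_nontrivial.mp (hB ▸ hp.out.one_lt)
    rw [zero_mul, zero_add]
    exact Finite.one_lt_card
  | succ a ih =>
    obtain ⟨N, hN⟩ := exists_subgroup_card_eq hA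
    obtain ⟨b, hb⟩ := exists_orderOf_eq_of_card (k := 0) (hB.trans (pow_one p).symm)
    have h1 := ih (card_quotient_of_card hA hN)
    have h2 := card_quotient_add_le hN hb
    linarith

lemma le_card_subgroup_prod [CommGroup A] [Finite A] [CommGroup B] [Finite B]
    {a b : ℕ} (hA : Nat.card A = p ^ (a + 1)) (hB : Nat.card B = p ^ (b + 1)) :
    (a + b + 1) * (p + 1) + 2 ≤ Nat.card (Subgroup (A × B)) := by
  induction a generalizing A with
  | zero =>
    rw [card_subgroup_congr (MulEquiv.prodComm (M := A) (N := B)), zero_add]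
    exact le_card_subgroup_prod_of_card_eq_prime hB (by simpa using hA)
  | succ a ih =>
    obtain ⟨N, hN⟩ := exists_subgroup_card_eq hA
    obtain ⟨y, hy⟩ := exists_orderOf_eq_of_card hB
    have h1 := ih (card_quotient_of_card hA hN)
    have h2 := card_quotient_add_le hN hy
    linarith

lemma lt_card_subgroup_prod [CommGroup A] [Finite A] [CommGroup B] [Finite B]
    {a b : ℕ} (hA : Nat.card A = p ^ (a + 2)) (hB : Nat.card B = p ^ (b + 1))
    {N : Subgroup A} (hN : Nat.card N = p) (H : Subgroup (A × B)) (hNH : ¬ N.prod ⊥ ≤ H)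
    (hH : p < Nat.card H) :
    (a + b + 2) * (p + 1) + 2 < Nat.card (Subgroup (A × B)) := by
  obtain ⟨y, hy⟩ := exists_orderOf_eq_of_card hB
  have h1 := le_card_subgroup_prod (card_quotient_of_card hA hN) hB
  have h2 := card_quotient_add_lt hN hy H hNH hH
  linarith

lemma card_subgroup_cyclic_prod [CommGroup A] [Finite A] [IsCyclic A] [CommGroup B] [Finite B]
    {a : ℕ} (hA : Nat.card A = p ^ a) (hB : Nat.card B = p) :
    Nat.card (Subgroup (A × B)) = a * (p + 1) + 2 := by
  induction a generalizing A with
  | zero =>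
    have : Subsingleton A := Finite.card_le_one_iff_subsingleton.mp (by simp [hA])
    have hAB : Nat.card (A × B) = p := by rw [Nat.card_prod, hA, hB, pow_zero, one_mul]
    have : Fact (Nat.card (A × B)).Prime := ⟨hAB ▸ hp.out⟩
    have : IsSimpleGroup (A × B) := isSimpleGroup_of_prime_card hAB
    have : IsSimpleOrder (Subgroup (A × B)) := inferInstance
    classical
    rw [Nat.card_congr IsSimpleOrder.equivBool]
    simp
  | succ a ih =>
    obtain ⟨N, hN⟩ := exists_subgroup_card_eq hA
    obtain ⟨b, hb⟩ := exists_orderOf_eq_of_card (k := 0) (hB.trans (pow_one p).symm)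
    rw [card_quotient_add_eq hA hB hN hb, ih (card_quotient_of_card hA hN)]
    ring

/-- A finite abelian group that is not cyclic splits as a product of nontrivial groups. -/
lemma exists_mulEquiv_prod_of_not_isCyclic [CommGroup G] [Finite G] (hG : ¬ IsCyclic G) :
    ∃ (A B : Type) (_ : CommGroup A) (_ : CommGroup B),
      Nontrivial A ∧ Nontrivial B ∧ Nonempty (G ≃* A × B) := by
  classical
  obtain ⟨ι, _, n, hn, ⟨e⟩⟩ := CommGroup.equiv_prod_multiplicative_zmod_of_finite G
  have hnt : ∀ i, Nontrivial (Multiplicative (ZMod (n i))) := fun i => by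
    have : Fact (1 < n i) := ⟨hn i⟩
    infer_instance
  have hι : Nontrivial ι := by
    by_contra h
    rw [not_nontrivial_iff_subsingleton] at h
    refine hG (e.isCyclic.mpr ?_)
    rcases isEmpty_or_nonempty ι with _ | ⟨⟨i⟩⟩
    · infer_instance
    · have : Unique ι := uniqueOfSubsingleton i
      exact (MulEquiv.piUnique fun i => Multiplicative (ZMod (n i))).isCyclic.mpr inferInstance
  obtain ⟨i, j, hij⟩ := exists_pair_ne ι
  refine ⟨Multiplicative (ZMod (n i)), ∀ k : {k // k ≠ i}, Multiplicative (ZMod (n k)),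
    inferInstance, inferInstance, hnt i, ?_,
    ⟨e.trans { Equiv.piSplitAt i _ with map_mul' := fun _ _ => rfl }⟩⟩
  have : Inhabited {k // k ≠ i} := ⟨⟨j, hij.symm⟩⟩
  exact Pi.nontrivial

lemma exists_prod_of_card_eq_pow [CommGroup G] [Finite G] {n : ℕ} (hcard : Nat.card G = p ^ n)
    (hG : ¬ IsCyclic G) :
    ∃ (A B : Type) (_ : CommGroup A) (_ : CommGroup B) (_ : Finite A) (_ : Finite B) (a b : ℕ),
      Nat.card A = p ^ (a + 1) ∧ Nat.card B = p ^ (b + 1) ∧ a + b + 2 = n ∧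
        Nonempty (G ≃* A × B) := by
  obtain ⟨A, B, _, _, _, _, ⟨e⟩⟩ := exists_mulEquiv_prod_of_not_isCyclic hG
  have hfin : Finite (A × B) := Finite.of_equiv G e.toEquiv
  have hfA : Finite A := Finite.prod_left B
  have hfB : Finite B := Finite.prod_right A
  have hAB : Nat.card A * Nat.card B = p ^ n := by
    rw [← Nat.card_prod, ← hcard, Nat.card_congr e.toEquiv]
  have key : ∀ k : ℕ, 1 < k → k ∣ p ^ n → ∃ a, k = p ^ (a + 1) := by
    intro k hk hkd
    obtain ⟨a, -, rfl⟩ := (Nat.dvd_prime_pow hp.out).mp hkd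
    cases a with
    | zero => simp at hk
    | succ a => exact ⟨a, rfl⟩
  obtain ⟨a, ha⟩ := key _ (Finite.one_lt_card (α := A)) (Dvd.intro _ hAB)
  obtain ⟨b, hb⟩ := key _ (Finite.one_lt_card (α := B)) (Dvd.intro_left _ hAB)
  refine ⟨A, B, _, _, hfA, hfB, a, b, ha, hb, ?_, ⟨e⟩⟩
  rw [ha, hb, ← pow_add] at hAB
  have := Nat.pow_right_injective hp.out.two_le hAB
  omega

lemma lt_card_subgroup_prod_of_sq_dvd [CommGroup A] [Finite A] [CommGroup B] [Finite B]
    {a b : ℕ} (hA : Nat.card A = p ^ (a + 2)) (hB : Nat.card B = p ^ (b + 2)) :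
    (a + b + 3) * (p + 1) + 2 < Nat.card (Subgroup (A × B)) := by
  obtain ⟨N, hN⟩ := exists_subgroup_card_eq hA
  refine lt_card_subgroup_prod (b := b + 1) hA hB hN (Subgroup.prod ⊥ ⊤) ?_ ?_
  · intro h
    have hbot : N = ⊥ := (Subgroup.eq_bot_iff_forall N).mpr fun x hx =>
      (h (show (x, (1 : B)) ∈ N.prod ⊥ from ⟨hx, Subgroup.mem_bot.mpr rfl⟩)).1
    rw [hbot, Subgroup.card_bot] at hN
    exact hp.out.one_lt.ne hN
  · rw [Nat.card_congr (Subgroup.prodEquiv _ _).toEquiv, Nat.card_prod, Subgroup.card_bot,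
      Subgroup.card_top, one_mul, hB]
    exact lt_self_pow₀ hp.out.one_lt (by omega)

lemma lt_card_subgroup_prod_of_not_isCyclic [CommGroup A] [Finite A] [CommGroup B] [Finite B]
    {a : ℕ} (hA : Nat.card A = p ^ a) (hB : Nat.card B = p) (hcyc : ¬ IsCyclic A) :
    a * (p + 1) + 2 < Nat.card (Subgroup (A × B)) := by
  obtain ⟨C, D, _, _, _, _, c, d, hC, hD, rfl, ⟨e⟩⟩ := exists_prod_of_card_eq_pow hA hcyc
  rw [card_subgroup_congr (e.prodCongr (MulEquiv.refl B))]
  obtain ⟨N, hN⟩ := exists_subgroup_card_eq hC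
  have hCD : Nat.card (C × D) = p ^ (c + d + 2) := by
    rw [← hA, Nat.card_congr e.toEquiv]
  have hNprod : Nat.card (N.prod (⊥ : Subgroup D)) = p := by
    rw [Nat.card_congr (Subgroup.prodEquiv _ _).toEquiv, Nat.card_prod, Subgroup.card_bot, hN,
      mul_one]
  refine lt_card_subgroup_prod (b := 0) hCD (by simpa using hB) hNprod
    (Subgroup.prod (Subgroup.prod ⊥ ⊤) ⊤) ?_ ?_
  · intro h
    have hbot : N = ⊥ := (Subgroup.eq_bot_iff_forall N).mpr fun x hx =>
      (h (show ((x, (1 : D)), (1 : B)) ∈ (N.prod ⊥).prod ⊥ from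
        ⟨⟨hx, Subgroup.mem_bot.mpr rfl⟩, Subgroup.mem_bot.mpr rfl⟩)).1.1
    rw [hbot, Subgroup.card_bot] at hN
    exact hp.out.one_lt.ne hN
  · rw [Nat.card_congr (Subgroup.prodEquiv _ _).toEquiv, Nat.card_prod,
      Nat.card_congr (Subgroup.prodEquiv _ _).toEquiv, Nat.card_prod, Subgroup.card_bot,
      Subgroup.card_top, Subgroup.card_top, one_mul, hB, hD, ← pow_succ]
    exact lt_self_pow₀ hp.out.one_lt (by omega)

instance finite_multiplicative_zmod_pow (k : ℕ) : Finite (Multiplicative (ZMod (p ^ k))) :=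
  have : NeZero (p ^ k) := ⟨pow_ne_zero k hp.out.ne_zero⟩
  inferInstanceAs (Finite (ZMod (p ^ k)))

lemma natCard_multiplicative_zmod (m : ℕ) : Nat.card (Multiplicative (ZMod m)) = m := by
  rw [Nat.card_congr Multiplicative.toAdd, Nat.card_zmod]

lemma card_subgroup_zmod_prod (m : ℕ) :
    Nat.card (Subgroup (Multiplicative (ZMod p) × Multiplicative (ZMod (p ^ m)))) =
      m * (p + 1) + 2 := by
  have : Finite (Multiplicative (ZMod p)) := inferInstanceAs (Finite (ZMod p))
  rw [card_subgroup_congr MulEquiv.prodComm]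
  exact card_subgroup_cyclic_prod (natCard_multiplicative_zmod _) (natCard_multiplicative_zmod _)

lemma lt_card_subgroup_or_nonempty_mulEquiv_of_prod [CommGroup A] [Finite A] [CommGroup B]
    [Finite B] {m : ℕ} (hA : Nat.card A = p ^ m) (hB : Nat.card B = p) :
    m * (p + 1) + 2 < Nat.card (Subgroup (A × B)) ∨
      Nonempty (A × B ≃* Multiplicative (ZMod p) × Multiplicative (ZMod (p ^ m))) := by
  by_cases hcyc : IsCyclic A
  · have : IsCyclic B := isCyclic_of_prime_card hB
    exact .inr ⟨MulEquiv.prodComm.trans (MulEquiv.prodCongr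
      (mulEquivOfCyclicCardEq (hB.trans (natCard_multiplicative_zmod _).symm))
      (mulEquivOfCyclicCardEq (hA.trans (natCard_multiplicative_zmod _).symm)))⟩
  · exact .inl (lt_card_subgroup_prod_of_not_isCyclic hA hB hcyc)

lemma lt_card_subgroup_or_nonempty_mulEquiv [CommGroup G] [Finite G] {m : ℕ}
    (hcard : Nat.card G = p ^ (m + 1)) (hm : 2 ≤ m) (hG : ¬ IsCyclic G) :
    m * (p + 1) + 2 < Nat.card (Subgroup G) ∨
      Nonempty (G ≃* Multiplicative (ZMod p) × Multiplicative (ZMod (p ^ m))) := by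
  obtain ⟨A, B, _, _, _, _, a, b, hA, hB, hab, ⟨e⟩⟩ := exists_prod_of_card_eq_pow hcard hG
  rcases b with _ | b
  · obtain rfl : m = a + 1 := by omega
    rw [card_subgroup_congr e]
    exact (lt_card_subgroup_or_nonempty_mulEquiv_of_prod hA (by simpa using hB)).imp_right
      fun ⟨f⟩ => ⟨e.trans f⟩
  rcases a with _ | a
  · obtain rfl : m = b + 1 + 1 := by omega
    have e' := e.trans MulEquiv.prodComm
    rw [card_subgroup_congr e']
    exact (lt_card_subgroup_or_nonempty_mulEquiv_of_prod hB (by simpa using hA)).imp_right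
      fun ⟨f⟩ => ⟨e'.trans f⟩
  · obtain rfl : m = a + b + 3 := by omega
    rw [card_subgroup_congr e]
    exact .inl (lt_card_subgroup_prod_of_sq_dvd hA hB)

end SubgroupCount

open SubgroupCount in
theorem stmt_2 (p n : ℕ) (hp : p.Prime) (hn : 3 ≤ n)
    (G : Type) [CommGroup G] [Finite G]
    (hcard : Nat.card G = p ^ n) (hnc : ¬ IsCyclic G) :
    beta (Multiplicative (ZMod p) × Multiplicative (ZMod (p ^ (n - 1))))
      = (((n : ℝ) - 1) * ((p : ℝ) + 1) + 2) / (p : ℝ) ^ n ∧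
    beta G ≥ (((n : ℝ) - 1) * ((p : ℝ) + 1) + 2) / (p : ℝ) ^ n ∧
    (beta G = (((n : ℝ) - 1) * ((p : ℝ) + 1) + 2) / (p : ℝ) ^ n ↔
      Nonempty (G ≃* Multiplicative (ZMod p) × Multiplicative (ZMod (p ^ (n - 1))))) := by
  have : Fact p.Prime := ⟨hp⟩
  obtain ⟨m, rfl⟩ : ∃ m, n = m + 1 := ⟨n - 1, by omega⟩
  rw [Nat.add_sub_cancel]
  have hpos : (0 : ℝ) < (p : ℝ) ^ (m + 1) := pow_pos (Nat.cast_pos.mpr hp.pos) _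
  have hnum : (((m + 1 : ℕ) : ℝ) - 1) * ((p : ℝ) + 1) + 2 = ((m * (p + 1) + 2 : ℕ) : ℝ) := by
    push_cast
    ring
  have hG : beta G = (Nat.card (Subgroup G) : ℝ) / (p : ℝ) ^ (m + 1) := by
    rw [beta, hcard, Nat.cast_pow]
  rw [hnum, hG, ge_iff_le, div_le_div_iff_of_pos_right hpos, div_left_inj' hpos.ne', Nat.cast_le,
    Nat.cast_inj]
  have hiso : Nonempty (G ≃* Multiplicative (ZMod p) × Multiplicative (ZMod (p ^ m))) →
      Nat.card (Subgroup G) = m * (p + 1) + 2 := fun ⟨e⟩ => by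
    rw [card_subgroup_congr e, card_subgroup_zmod_prod]
  have halt := lt_card_subgroup_or_nonempty_mulEquiv hcard (by omega) hnc
  refine ⟨?_, ?_, fun h => halt.resolve_left h.not_gt, hiso⟩
  · rw [beta, card_subgroup_zmod_prod, Nat.card_prod, natCard_multiplicative_zmod,
      natCard_multiplicative_zmod, ← pow_succ', Nat.cast_pow]
  · exact halt.elim le_of_lt fun h => (hiso h).ge
end

section
/- Let p be an odd prime, n ≥ 3 an integer, and G a group of order p^n that is not cyclic. Then β(G) ≥ β(Z_p × Z_{p^{n-1}}) = β(M(p^n)) = ((n-1)(p+1)+2)/p^n, and equality holds if and only if G is isomorphic to Z_p × Z_{p^{n-1}} or to M(p^n). -/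
/-- Relations of the modular `p`-group `M(p^n)`:
`x^(p^(n-1)) = 1`, `y^p = 1`, `y⁻¹ x y = x^(1 + p^(n-2))`. -/
def modularRels (p n : ℕ) : Set (FreeGroup (Fin 2)) :=
  { FreeGroup.of 0 ^ (p ^ (n - 1)),
    FreeGroup.of 1 ^ p,
    (FreeGroup.of 1)⁻¹ * FreeGroup.of 0 * FreeGroup.of 1 *
      (FreeGroup.of 0 ^ (1 + p ^ (n - 2)))⁻¹ }

/-- The modular `p`-group `M(p^n)` given by its presentation. -/
def ModularGroup (p n : ℕ) : Type := PresentedGroup (modularRels p n)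

instance (p n : ℕ) : Group (ModularGroup p n) := by
  unfold ModularGroup; infer_instance

open Subgroup
open scoped commutatorElement

section CyclicMaximal

variable {G : Type*} [Group G] {p m : ℕ} [hp : Fact p.Prime]

theorem index_zpowers_of_orderOf (hcard : Nat.card G = p ^ (m + 3)) {a : G}
    (ha : orderOf a = p ^ (m + 2)) : (zpowers a).index = p := by
  have h := (zpowers a).card_mul_index
  rw [Nat.card_zpowers, ha, hcard, pow_succ p (m + 2)] at h
  exact Nat.eq_of_mul_eq_mul_left (pow_pos hp.out.pos _) h

theorem normal_zpowers_of_orderOf [Finite G] (hcard : Nat.card G = p ^ (m + 3)) {a : G}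
    (ha : orderOf a = p ^ (m + 2)) : (zpowers a).Normal := by
  apply normal_of_index_eq_minFac_card
  rw [index_zpowers_of_orderOf hcard ha, hcard, hp.out.pow_minFac (by omega)]

theorem pow_dvd_sub_one_of_pow_dvd_pow_sub_one (hodd : Odd p) {k : ℤ} {t : ℕ}
    (h : (p : ℤ) ^ (t + 1) ∣ k ^ p - 1) : (p : ℤ) ^ t ∣ k - 1 := by
  have hk : (p : ℤ) ∣ k - 1 := by
    have h1 : (p : ℤ) ∣ k ^ p - 1 := (dvd_pow_self _ (by omega)).trans h
    rw [← ZMod.intCast_zmod_eq_zero_iff_dvd] at h1 ⊢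
    push_cast at h1 ⊢
    rwa [ZMod.pow_card] at h1
  have hk' : ¬ (p : ℤ) ∣ k := fun h2 => by
    have := dvd_sub h2 hk
    rw [sub_sub_cancel] at this
    exact hp.out.one_lt.ne' (by exact_mod_cast Int.eq_one_of_dvd_one (by positivity) this)
  have key := Int.emultiplicity_pow_sub_pow hp.out hodd hk hk' p
  have hpp : emultiplicity p p = 1 := by
    simpa using (Nat.finiteMultiplicity_iff.2 ⟨hp.out.ne_one, hp.out.pos⟩).emultiplicity_self
  rw [one_pow, hpp] at key
  rw [pow_dvd_iff_le_emultiplicity, key] at h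
  rw [pow_dvd_iff_le_emultiplicity]
  push_cast at h
  exact (ENat.add_le_add_iff_right (by simp)).1 h

theorem conj_pow_eq_zpow {a g : G} {k : ℤ} (hk : g * a * g⁻¹ = a ^ k) (i : ℕ) :
    g ^ i * a * (g ^ i)⁻¹ = a ^ (k ^ i) := by
  induction i with
  | zero => simp
  | succ i ih =>
    calc g ^ (i + 1) * a * (g ^ (i + 1))⁻¹ = g * (g ^ i * a * (g ^ i)⁻¹) * g⁻¹ := by
          rw [pow_succ']; group
      _ = (g * a * g⁻¹) ^ (k ^ i) := by rw [ih, conj_zpow]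
      _ = a ^ (k ^ (i + 1)) := by rw [hk, ← zpow_mul, pow_succ']

theorem mul_pow_of_commutator_mem_center {x y : G} (h : ⁅y, x⁆ ∈ center G) (i : ℕ) :
    (x * y) ^ i = x ^ i * y ^ i * ⁅y, x⁆ ^ i.choose 2 := by
  set c := ⁅y, x⁆ with hc
  have hcc : ∀ g, Commute c g := fun g => (mem_center_iff.1 h g).symm
  have hyx : y * x = x * y * c := by
    rw [(show x * y * c = c * (x * y) from (hcc _).eq.symm), hc, commutatorElement_def]; group
  have hyix : ∀ i : ℕ, y ^ i * x = x * y ^ i * c ^ i := by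
    intro i
    induction i with
    | zero => simp
    | succ i ih =>
      calc y ^ (i + 1) * x = y ^ i * (y * x) := by rw [pow_succ]; group
        _ = y ^ i * x * (y * c) := by rw [hyx]; group
        _ = x * y ^ i * (c ^ i * y) * c := by rw [ih]; group
        _ = x * y ^ (i + 1) * c ^ (i + 1) := by
          rw [((hcc y).pow_left i).eq, pow_succ, pow_succ]; group
  induction i with
  | zero => simp
  | succ i ih =>
    calc (x * y) ^ (i + 1) = x ^ i * y ^ i * (c ^ i.choose 2 * (x * y)) := by
          rw [pow_succ, ih]; group
      _ = x ^ i * (y ^ i * x) * y * c ^ i.choose 2 := by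
          rw [((hcc (x * y)).pow_left _).eq]; group
      _ = x ^ (i + 1) * y ^ i * (c ^ i * y) * c ^ i.choose 2 := by
          rw [hyix, pow_succ]; group
      _ = x ^ (i + 1) * y ^ (i + 1) * c ^ (i + 1).choose 2 := by
          rw [((hcc y).pow_left i).eq, Nat.choose_succ_succ' i 1, Nat.choose_one_right, pow_add,
            pow_succ y]
          group

theorem orderOf_pow_prime_pow {a : G} {k i : ℕ} (ha : orderOf a = p ^ (k + i)) :
    orderOf (a ^ p ^ i) = p ^ k := by
  rw [orderOf_pow_of_dvd (pow_ne_zero _ hp.out.ne_zero) (by rw [ha, pow_add]; exact dvd_mul_left _ _),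
    ha, pow_add, Nat.mul_div_cancel _ (pow_pos hp.out.pos _)]

variable [Finite G]

theorem exists_conj_eq_mul_zpow (hodd : Odd p) (hcard : Nat.card G = p ^ (m + 3)) {a : G}
    (ha : orderOf a = p ^ (m + 2)) (g : G) :
    ∃ j : ℤ, g * a * g⁻¹ = a * (a ^ p ^ (m + 1)) ^ j := by
  have hn := normal_zpowers_of_orderOf hcard ha
  obtain ⟨k, hk⟩ := mem_zpowers_iff.1 (hn.conj_mem a (mem_zpowers a) g)
  obtain ⟨r, hr⟩ : ∃ r : ℤ, a ^ r = g ^ p := by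
    rw [← mem_zpowers_iff]
    have := (zpowers a).pow_index_mem g
    rwa [index_zpowers_of_orderOf hcard ha] at this
  have h1 := conj_pow_eq_zpow hk.symm p
  rw [← hr, (Commute.zpow_self a r).eq, mul_inv_cancel_right] at h1
  have h2 : a ^ (k ^ p - 1) = 1 := by
    rw [zpow_sub_one, ← h1, mul_inv_cancel]
  rw [← orderOf_dvd_iff_zpow_eq_one, ha] at h2
  obtain ⟨j, hj⟩ := pow_dvd_sub_one_of_pow_dvd_pow_sub_one hodd (t := m + 1) (by exact_mod_cast h2)
  refine ⟨j, ?_⟩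
  rw [← hk, ← zpow_natCast, ← zpow_mul, ← zpow_one_add]
  congr 1
  push_cast
  linarith

theorem pow_mem_center_of_orderOf (hodd : Odd p) (hcard : Nat.card G = p ^ (m + 3)) {a : G}
    (ha : orderOf a = p ^ (m + 2)) : a ^ p ^ (m + 1) ∈ center G := by
  rw [mem_center_iff]
  intro g
  obtain ⟨j, hj⟩ := exists_conj_eq_mul_zpow hodd hcard ha g
  rw [← mul_inv_eq_iff_eq_mul, ← conj_pow, hj]
  have hc : Commute a ((a ^ p ^ (m + 1)) ^ j) := ((Commute.refl a).pow_right _).zpow_right _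
  rw [hc.mul_pow, mul_eq_left, ← zpow_natCast (_ ^ j), zpow_comm, zpow_natCast, ← pow_mul]
  rw [show p ^ (m + 1) * p ^ (m + 1) = p ^ (m + 2) * p ^ m by ring, pow_mul, ← ha,
    pow_orderOf_eq_one, one_pow, one_zpow]

theorem commutator_mem_zpowers (hodd : Odd p) (hcard : Nat.card G = p ^ (m + 3)) {a : G}
    (ha : orderOf a = p ^ (m + 2)) (x y : G) : ⁅x, y⁆ ∈ zpowers (a ^ p ^ (m + 1)) := by
  have hn := normal_zpowers_of_orderOf hcard ha
  set Z := zpowers (a ^ p ^ (m + 1)) with hZ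
  have hZc : Z ≤ center G := by
    rw [hZ, zpowers_le]; exact pow_mem_center_of_orderOf hodd hcard ha
  have hZn : Z.Normal := ⟨fun z hz g => by
    rw [mem_center_iff.1 (hZc hz) g, mul_inv_cancel_right]; exact hz⟩
  have hZA : Z ≤ zpowers a := by
    rw [hZ, zpowers_le]; exact pow_mem (mem_zpowers a) _
  have hcyc : IsCyclic (G ⧸ zpowers a) :=
    isCyclic_of_prime_card (p := p) (index_zpowers_of_orderOf hcard ha)
  let f : G ⧸ Z →* G ⧸ zpowers a :=
    QuotientGroup.lift Z (QuotientGroup.mk' (zpowers a)) (by simpa using hZA)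
  have hf : f.ker ≤ center (G ⧸ Z) := by
    intro q hq
    obtain ⟨g, rfl⟩ := QuotientGroup.mk_surjective q
    have hg : g ∈ zpowers a := by
      rw [MonoidHom.mem_ker] at hq
      exact (QuotientGroup.eq_one_iff g).1 hq
    have hac : (a : G ⧸ Z) ∈ center (G ⧸ Z) := by
      rw [mem_center_iff]
      intro q
      obtain ⟨h, rfl⟩ := QuotientGroup.mk_surjective q
      obtain ⟨j, hj⟩ := exists_conj_eq_mul_zpow hodd hcard ha h
      have : ((h * a * h⁻¹ : G) : G ⧸ Z) = a := by
        rw [hj, QuotientGroup.mk_mul, mul_eq_left, QuotientGroup.eq_one_iff]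
        exact zpow_mem (mem_zpowers _) _
      simpa [mul_inv_eq_iff_eq_mul] using this
    obtain ⟨i, rfl⟩ := mem_zpowers_iff.1 hg
    simpa using zpow_mem hac i
  have hcomm := (f.isMulCommutative_of_isCyclic_of_ker_le_center hf).is_comm.comm
    (x : G ⧸ Z) (y : G ⧸ Z)
  rw [← QuotientGroup.eq_one_iff, ← QuotientGroup.mk'_apply, map_commutatorElement,
    commutatorElement_eq_one_iff_mul_comm]
  exact hcomm

theorem mul_pow_of_orderOf (hodd : Odd p) (hcard : Nat.card G = p ^ (m + 3)) {a : G}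
    (ha : orderOf a = p ^ (m + 2)) (x y : G) : (x * y) ^ p = x ^ p * y ^ p := by
  have hmem := commutator_mem_zpowers hodd hcard ha y x
  have hz : zpowers (a ^ p ^ (m + 1)) ≤ center G := by
    rw [zpowers_le]; exact pow_mem_center_of_orderOf hodd hcard ha
  rw [mul_pow_of_commutator_mem_center (hz hmem), mul_eq_left]
  obtain ⟨j, hj⟩ := mem_zpowers_iff.1 hmem
  obtain ⟨t, ht⟩ : p ∣ p.choose 2 := hp.out.dvd_choose_self (by norm_num)
    (lt_of_le_of_ne hp.out.two_le (by rintro rfl; exact absurd hodd (by decide)))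
  rw [← hj, ht, pow_mul, ← zpow_natCast (_ ^ j) p, zpow_comm, zpow_natCast, ← pow_mul,
    ← pow_succ, ← ha, pow_orderOf_eq_one, one_zpow, one_pow]

/-- The `p ^ i`-th power map of a `p`-group with a cyclic maximal subgroup, `p` odd. -/
def primePowHom (hodd : Odd p) (hcard : Nat.card G = p ^ (m + 3)) {a : G}
    (ha : orderOf a = p ^ (m + 2)) (i : ℕ) : G →* G :=
  MonoidHom.mk' (fun x => x ^ p ^ i) fun x y => by
    induction i with
    | zero => simp
    | succ i ih => simp only [pow_succ p, pow_mul, ih, mul_pow_of_orderOf hodd hcard ha]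

theorem pow_mem_zpowers_pow (hcard : Nat.card G = p ^ (m + 3)) (hnc : ¬ IsCyclic G) {a : G}
    (ha : orderOf a = p ^ (m + 2)) (x : G) : x ^ p ∈ zpowers (a ^ p) := by
  have hn := normal_zpowers_of_orderOf hcard ha
  classical
  have hmem := (zpowers a).pow_index_mem x
  rw [index_zpowers_of_orderOf hcard ha] at hmem
  obtain ⟨r, hr⟩ := (mem_zpowers_iff_mem_range_orderOf.trans Finset.mem_image).1 hmem
  by_cases hpr : p ∣ r
  · obtain ⟨s, rfl⟩ := hpr
    rw [← hr.2, pow_mul]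
    exact pow_mem (mem_zpowers _) s
  · exfalso
    have h1 : orderOf (x ^ p) = p ^ (m + 2) := by
      rw [← hr.2, Nat.Coprime.orderOf_pow, ha]
      rw [ha]
      exact Nat.Coprime.pow_left _ ((Nat.Prime.coprime_iff_not_dvd hp.out).2 hpr)
    apply hnc
    apply isCyclic_of_orderOf_eq_card x
    rw [hcard]
    apply orderOf_eq_prime_pow
    · intro h
      rw [show p ^ (m + 2) = p * p ^ (m + 1) by ring, pow_mul, ← orderOf_dvd_iff_pow_eq_one, h1,
        Nat.pow_dvd_pow_iff_le_right hp.out.one_lt] at h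
      omega
    · rw [← hcard]; exact pow_card_eq_one'

theorem range_primePowHom (hodd : Odd p) (hcard : Nat.card G = p ^ (m + 3)) (hnc : ¬ IsCyclic G)
    {a : G} (ha : orderOf a = p ^ (m + 2)) (i : ℕ) :
    (primePowHom hodd hcard ha (i + 1)).range = zpowers (a ^ p ^ (i + 1)) := by
  apply le_antisymm
  · rintro _ ⟨x, rfl⟩
    obtain ⟨r, hr⟩ := mem_zpowers_iff.1 (pow_mem_zpowers_pow hcard hnc ha x)
    rw [mem_zpowers_iff]
    refine ⟨r, ?_⟩
    change _ = x ^ p ^ (i + 1)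
    rw [pow_succ', pow_mul, pow_mul, ← hr, ← zpow_natCast (_ ^ r), zpow_comm, zpow_natCast]
  · rw [zpowers_le]
    exact ⟨a, rfl⟩

theorem card_ker_primePowHom (hodd : Odd p) (hcard : Nat.card G = p ^ (m + 3))
    (hnc : ¬ IsCyclic G) {a : G} (ha : orderOf a = p ^ (m + 2)) {i : ℕ} (hi : i ≤ m) :
    Nat.card (primePowHom hodd hcard ha (i + 1)).ker = p ^ (i + 2) := by
  have h := (primePowHom hodd hcard ha (i + 1)).ker.card_mul_index
  rw [index_ker, range_primePowHom hodd hcard hnc ha, Nat.card_zpowers,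
    orderOf_pow_prime_pow (k := m + 1 - i) (by rw [ha]; congr 1; omega), hcard,
    show m + 3 = (i + 2) + (m + 1 - i) by omega, pow_add] at h
  exact Nat.eq_of_mul_eq_mul_right (pow_pos hp.out.pos _) h

theorem not_isCyclic_ker_primePowHom (hodd : Odd p) (hcard : Nat.card G = p ^ (m + 3))
    (hnc : ¬ IsCyclic G) {a : G} (ha : orderOf a = p ^ (m + 2)) {i : ℕ} (hi : i ≤ m) :
    ¬ IsCyclic (primePowHom hodd hcard ha (i + 1)).ker := by
  intro hc
  obtain ⟨g, hg⟩ := hc.exists_ofOrder_eq_natCard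
  rw [card_ker_primePowHom hodd hcard hnc ha hi] at hg
  have : g ^ p ^ (i + 1) = 1 := Subtype.ext g.2
  rw [← orderOf_dvd_iff_pow_eq_one, hg, Nat.pow_dvd_pow_iff_le_right hp.out.one_lt] at this
  omega

theorem orderOf_dvd_of_not_isCyclic {n : ℕ} (hcard : Nat.card G = p ^ (n + 1))
    (hnc : ¬ IsCyclic G) (x : G) : orderOf x ∣ p ^ n := by
  obtain ⟨t, ht, hx⟩ := (Nat.dvd_prime_pow hp.out).1 (hcard ▸ orderOf_dvd_natCard x)
  rw [hx, Nat.pow_dvd_pow_iff_le_right hp.out.one_lt]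
  by_contra hlt
  refine hnc (isCyclic_of_orderOf_eq_card x ?_)
  rw [hx, hcard, show t = n + 1 by omega]

/-- The elements of order at most `p ^ (m + 1)` form a noncyclic maximal subgroup, which again
has a cyclic maximal subgroup. -/
theorem exists_noncyclic_maximal (hodd : Odd p) (hcard : Nat.card G = p ^ (m + 3))
    (hnc : ¬ IsCyclic G) {a : G} (ha : orderOf a = p ^ (m + 2)) :
    ∃ M : Subgroup G, Nat.card M = p ^ (m + 2) ∧ ¬ IsCyclic M ∧
      (∃ b : M, orderOf b = p ^ (m + 1)) ∧ ∀ x ∉ M, orderOf x = p ^ (m + 2) := by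
  refine ⟨(primePowHom hodd hcard ha (m + 1)).ker, card_ker_primePowHom hodd hcard hnc ha le_rfl,
    not_isCyclic_ker_primePowHom hodd hcard hnc ha le_rfl, ⟨⟨a ^ p, ?_⟩, ?_⟩, fun x hx => ?_⟩
  · change (a ^ p) ^ p ^ (m + 1) = 1
    rw [← pow_mul, ← pow_succ', ← ha, pow_orderOf_eq_one]
  · rw [orderOf_mk]
    simpa using orderOf_pow_prime_pow (i := 1) ha
  · exact orderOf_eq_prime_pow hx
      (orderOf_dvd_iff_pow_eq_one.1 (orderOf_dvd_of_not_isCyclic hcard hnc x))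

theorem exists_pow_eq_one_notMem_zpowers (hodd : Odd p) (hcard : Nat.card G = p ^ (m + 3))
    (hnc : ¬ IsCyclic G) {a : G} (ha : orderOf a = p ^ (m + 2)) :
    ∃ y ∉ zpowers a, y ^ p = 1 := by
  by_contra! h
  refine not_isCyclic_ker_primePowHom hodd hcard hnc ha (Nat.zero_le m) ?_
  refine isCyclic_of_injective (inclusion (K := zpowers a) fun x hx => ?_) (inclusion_injective _)
  by_contra hxa
  refine h x hxa ?_
  have : x ^ p ^ (0 + 1) = 1 := hx
  simpa using this

end CyclicMaximal

section Counting

variable {G : Type*} [Group G] [Finite G] {p : ℕ} [hp : Fact p.Prime]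

theorem zpowers_ne_top_of_not_isCyclic {G : Type*} [Group G] (hnc : ¬ IsCyclic G) (x : G) :
    zpowers x ≠ ⊤ := fun h =>
  hnc ⟨x, fun y => show y ∈ zpowers x by rw [h]; trivial⟩

theorem card_subgroup_eq_add (M : Subgroup G) :
    Nat.card (Subgroup G) = Nat.card (Subgroup M) + {H : Subgroup G | ¬ H ≤ M}.ncard := by
  rw [Nat.card_congr (MapSubtype.orderIso M).toEquiv]
  have h := Set.ncard_add_ncard_compl {H : Subgroup G | H ≤ M}
  rw [← h]
  rfl

theorem ncard_generators (H : Subgroup G) [IsCyclic H] :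
    {x : G | zpowers x = H}.ncard = (Nat.card H).totient := by
  classical
  have := Fintype.ofFinite H
  rw [Nat.card_eq_fintype_card, ← IsCyclic.card_orderOf_eq_totient (α := H) dvd_rfl,
    ← Set.ncard_coe_finset, ← Set.ncard_image_of_injective _ H.subtype_injective]
  congr 1
  ext x
  simp only [Set.mem_ofPred_eq, Finset.coe_filter, Finset.mem_univ, true_and, Set.mem_image,
    ← Nat.card_eq_fintype_card]
  constructor
  · rintro rfl
    exact ⟨⟨x, mem_zpowers x⟩, by rw [orderOf_mk, Nat.card_zpowers], rfl⟩
  · rintro ⟨y, hy, rfl⟩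
    apply eq_of_le_of_card_ge
    · rw [zpowers_le]; exact y.2
    · rw [Nat.card_zpowers, ← hy, coe_subtype, orderOf_coe]

/-- The subgroups not contained in `M`, when all elements outside `M` have order `p ^ n`. -/
theorem ncard_not_le_of_orderOf {n t : ℕ} (hcard : Nat.card G = p ^ (n + 1))
    (hnc : ¬ IsCyclic G) {M : Subgroup G} (hMtop : M ≠ ⊤)
    (hM : ∀ x ∉ M, orderOf x = p ^ n) (ht : t * (p ^ n).totient + Nat.card M = p ^ (n + 1)) :
    {H : Subgroup G | ¬ H ≤ M}.ncard = t + 1 := by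
  classical
  have := Fintype.ofFinite G
  have := Fintype.ofFinite (Subgroup G)
  have hgen : ∀ H : Subgroup G, H ≠ ⊤ → ∀ x ∈ H, x ∉ M → zpowers x = H := by
    intro H hH x hx hxM
    apply eq_of_le_of_card_ge (by rwa [zpowers_le])
    rw [Nat.card_zpowers, hM x hxM]
    obtain ⟨k, hk, hk'⟩ := (Nat.dvd_prime_pow hp.out).1 (hcard ▸ H.card_subgroup_dvd_card)
    rw [hk']
    apply Nat.pow_le_pow_right hp.out.pos
    by_contra hlt
    apply hH
    rw [← card_eq_iff_eq_top, hk', hcard, show k = n + 1 by omega]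
  let S : Finset (Subgroup G) := {H | ¬ H ≤ M ∧ H ≠ ⊤}
  have hcount : (Finset.univ.filter fun x : G => x ∉ M).card = S.card * (p ^ n).totient := by
    rw [Finset.card_eq_sum_card_fiberwise (f := fun x : G => zpowers x) (t := S)]
    · refine Finset.sum_const_nat fun H hH => ?_
      obtain ⟨hHM, hHtop⟩ : ¬ H ≤ M ∧ H ≠ ⊤ := by simpa [S] using hH
      obtain ⟨x, hxH, hxM⟩ := SetLike.not_le_iff_exists.1 hHM
      have hxgen := hgen H hHtop x hxH hxM
      have hcyc : IsCyclic H := by rw [← hxgen]; infer_instance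
      rw [← hM x hxM, ← Nat.card_zpowers, hxgen, ← ncard_generators H, ← Set.ncard_coe_finset]
      congr 1
      ext y
      simp only [Finset.coe_filter, Finset.mem_filter, Finset.mem_univ, true_and,
        Set.mem_ofPred_eq, and_iff_right_iff_imp]
      rintro rfl hy
      exact hHM (by rwa [zpowers_le])
    · intro x hx
      have hxM : x ∉ M := by simpa using hx
      simpa [S, hxM] using zpowers_ne_top_of_not_isCyclic hnc x
  have hS : {H : Subgroup G | ¬ H ≤ M} = insert ⊤ (S : Set (Subgroup G)) := by
    ext H
    by_cases h : H = ⊤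
    · simp [h, S, hMtop]
    · simp [h, S]
  have hcompl : (Finset.univ.filter fun x : G => x ∉ M).card + Nat.card M = p ^ (n + 1) := by
    rw [← hcard, ← Set.ncard_coe_finset, ← Set.ncard_add_ncard_compl (M : Set G), add_comm]
    congr 1
    · congr 1; ext; simp
  have hφ : 0 < (p ^ n).totient := Nat.totient_pos.2 (pow_pos hp.out.pos _)
  have hSt : S.card = t := Nat.eq_of_mul_eq_mul_right hφ (by omega)
  rw [hS, Set.ncard_insert_of_notMem (by simp [S]), Set.ncard_coe_finset, hSt]

/-- A noncyclic group of order `p ^ (n + 1)` has at least `p + 1` maximal subgroups. -/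
theorem succ_le_ncard_maximal {n : ℕ} (hcard : Nat.card G = p ^ (n + 1))
    (hnc : ¬ IsCyclic G) : p + 1 ≤ {H : Subgroup G | Nat.card H = p ^ n}.ncard := by
  classical
  have := Fintype.ofFinite G
  have := Fintype.ofFinite (Subgroup G)
  set S : Finset (Subgroup G) := {H | Nat.card H = p ^ n} with hS
  have hcov : ∀ x : G, ∃ H ∈ S, x ∈ H := by
    intro x
    obtain ⟨k, hk, hk'⟩ :=
      (Nat.dvd_prime_pow hp.out).1 (orderOf_dvd_of_not_isCyclic hcard hnc x)
    obtain ⟨H, hH, hle⟩ := Sylow.exists_subgroup_card_pow_prime_le p (n := k) (m := n)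
      (by rw [hcard]; exact pow_dvd_pow _ (by omega)) (zpowers x) (by rw [Nat.card_zpowers, hk']) hk
    exact ⟨H, by simpa [hS] using hH, hle (mem_zpowers x)⟩
  have hsub : (Finset.univ.erase (1 : G)) ⊆
      S.biUnion fun H => (Finset.univ.filter (· ∈ H)).erase 1 := by
    intro x hx
    obtain ⟨H, hH, hxH⟩ := hcov x
    simp only [Finset.mem_biUnion, Finset.mem_erase, Finset.mem_filter, Finset.mem_univ, true_and]
    exact ⟨H, hH, Finset.ne_of_mem_erase hx, hxH⟩
  have hle := (Finset.card_le_card hsub).trans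
    (Finset.card_biUnion_le_card_mul S _ (p ^ n - 1) fun H hH => by
      rw [Finset.card_erase_of_mem (by simp [H.one_mem])]
      have : Nat.card H = p ^ n := by simpa [hS] using hH
      rw [← this, Nat.card_eq_fintype_card, Fintype.card_subtype])
  rw [Finset.card_erase_of_mem (Finset.mem_univ _), Finset.card_univ, ← Nat.card_eq_fintype_card,
    hcard] at hle
  have hncard : {H : Subgroup G | Nat.card H = p ^ n}.ncard = S.card := by
    rw [← Set.ncard_coe_finset]; simp [hS]
  rw [hncard]
  by_contra! hlt
  have h1 := hle.trans (Nat.mul_le_mul_right _ (Nat.lt_succ_iff.1 hlt))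
  have h2 := hp.out.two_le
  have h3 : 0 < p ^ n := pow_pos hp.out.pos _
  have h4 : p ≤ p * p ^ n := Nat.le_mul_of_pos_right _ h3
  rw [pow_succ', Nat.mul_sub] at h1
  omega

theorem ncard_not_le_ge {n : ℕ} (hcard : Nat.card G = p ^ (n + 1))
    (hnc : ¬ IsCyclic G) {M : Subgroup G} (hM : Nat.card M = p ^ n) :
    p + 1 ≤ {H : Subgroup G | ¬ H ≤ M}.ncard ∧
    ({H : Subgroup G | ¬ H ≤ M}.ncard = p + 1 → ∃ a : G, orderOf a = p ^ n) := by
  have hlt : p ^ n < p ^ (n + 1) := Nat.pow_lt_pow_right hp.out.one_lt (by omega)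
  set S := {H : Subgroup G | Nat.card H = p ^ n} with hS
  have hSM : M ∈ S := hM
  have hMtop : M ≠ ⊤ := by
    rintro rfl; rw [card_top, hcard] at hM; omega
  have htop : (⊤ : Subgroup G) ∉ S \ {M} := fun h => by
    have h1 : Nat.card (⊤ : Subgroup G) = p ^ n := h.1
    rw [card_top, hcard] at h1; omega
  have hsub : insert ⊤ (S \ {M}) ⊆ {H : Subgroup G | ¬ H ≤ M} := by
    rintro H (rfl | ⟨hH, hne⟩) hle
    · exact hMtop (top_le_iff.1 hle)
    · exact hne (eq_of_le_of_card_ge hle (by rw [hM, show Nat.card H = p ^ n from hH]))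
  have hcnt : (insert ⊤ (S \ {M})).ncard = S.ncard := by
    rw [Set.ncard_insert_of_notMem htop, Set.ncard_sdiff_singleton_add_one hSM]
  have hge : p + 1 ≤ S.ncard := succ_le_ncard_maximal hcard hnc
  have hmono := Set.ncard_le_ncard hsub
  refine ⟨by omega, fun heq => ?_⟩
  have hset := Set.eq_of_subset_of_ncard_le hsub (by omega)
  obtain ⟨x, hx⟩ : ∃ x, x ∉ M := by
    by_contra! h
    exact hMtop ((eq_top_iff' M).2 h)
  have hxm : zpowers x ∈ {H : Subgroup G | ¬ H ≤ M} := by simpa using hx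
  rw [← hset] at hxm
  rcases hxm with h | h
  · exact absurd h (zpowers_ne_top_of_not_isCyclic hnc x)
  · exact ⟨x, by rw [← Nat.card_zpowers]; exact h.1⟩

theorem card_subgroup_of_card_sq (hcard : Nat.card G = p ^ 2) (hnc : ¬ IsCyclic G) :
    Nat.card (Subgroup G) = p + 3 := by
  have hbot : (⊥ : Subgroup G) ≠ ⊤ := by
    intro h
    have h1 := hcard
    rw [← card_top, ← h, card_bot] at h1
    exact (Nat.one_lt_pow (by norm_num) hp.out.one_lt).ne h1
  have := ncard_not_le_of_orderOf (n := 1) (t := p + 1) hcard hnc hbot (fun x hx => by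
    rw [pow_one]
    refine orderOf_eq_prime (orderOf_dvd_iff_pow_eq_one.1 ?_) (by simpa using hx)
    simpa using orderOf_dvd_of_not_isCyclic (n := 1) hcard hnc x) (by
      rw [pow_one, Nat.totient_prime hp.out, card_bot]
      obtain ⟨q, hq⟩ : ∃ q, p = q + 1 := ⟨p - 1, by have := hp.out.pos; omega⟩
      rw [hq, Nat.add_sub_cancel]; ring)
  rw [card_subgroup_eq_add ⊥, this, Nat.card_unique]
  ring

/-- A noncyclic group of odd order `p ^ (m + 2)` with a cyclic maximal subgroup has exactly
`(m + 1) * (p + 1) + 2` subgroups. -/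
theorem card_subgroup_of_cyclic_maximal (hodd : Odd p) {m : ℕ} {G : Type*} [Group G] [Finite G]
    (hcard : Nat.card G = p ^ (m + 2)) (hnc : ¬ IsCyclic G) {a : G}
    (ha : orderOf a = p ^ (m + 1)) : Nat.card (Subgroup G) = (m + 1) * (p + 1) + 2 := by
  induction m generalizing G with
  | zero => rw [card_subgroup_of_card_sq hcard hnc]; ring
  | succ m ih =>
    obtain ⟨M, hM, hMnc, ⟨b, hb⟩, hord⟩ := exists_noncyclic_maximal hodd hcard hnc ha
    have hMtop : M ≠ ⊤ := by
      rintro rfl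
      rw [card_top, hcard] at hM
      exact absurd (Nat.pow_right_injective hp.out.two_le hM) (by omega)
    rw [card_subgroup_eq_add M, ih hM hMnc hb,
      ncard_not_le_of_orderOf (n := m + 2) (t := p) hcard hnc hMtop hord (by
        rw [hM, Nat.totient_prime_pow_succ hp.out]
        obtain ⟨q, hq⟩ : ∃ q, p = q + 1 := ⟨p - 1, by have := hp.out.pos; omega⟩
        rw [hq, Nat.add_sub_cancel]; ring)]
    ring

theorem exists_noncyclic_card_eq (hodd : Odd p) {m : ℕ} (hcard : Nat.card G = p ^ (m + 3))
    (hnc : ¬ IsCyclic G) : ∃ M : Subgroup G, Nat.card M = p ^ (m + 2) ∧ ¬ IsCyclic M := by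
  by_contra! h
  obtain ⟨M, hM⟩ := Sylow.exists_subgroup_card_pow_prime (G := G) p (n := m + 2)
    (by rw [hcard]; exact pow_dvd_pow _ (by omega))
  obtain ⟨a, ha⟩ := (h M hM).exists_ofOrder_eq_natCard
  obtain ⟨N, hN, hNnc, -⟩ := exists_noncyclic_maximal hodd hcard hnc (a := (a : G))
    (by rw [orderOf_coe, ha, hM])
  exact hNnc (h N hN)

theorem le_card_subgroup (hodd : Odd p) {m : ℕ} {G : Type*} [Group G] [Finite G]
    (hcard : Nat.card G = p ^ (m + 2)) (hnc : ¬ IsCyclic G) :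
    (m + 1) * (p + 1) + 2 ≤ Nat.card (Subgroup G) := by
  induction m generalizing G with
  | zero => rw [card_subgroup_of_card_sq hcard hnc]; exact le_of_eq (by ring)
  | succ m ih =>
    obtain ⟨M, hM, hMnc⟩ := exists_noncyclic_card_eq hodd hcard hnc
    have h1 := ih hM hMnc
    have h2 := (ncard_not_le_ge hcard hnc hM).1
    rw [card_subgroup_eq_add M, show (m + 1 + 1) * (p + 1) = (m + 1) * (p + 1) + (p + 1) by ring]
    omega

theorem exists_orderOf_of_card_subgroup_eq (hodd : Odd p) {m : ℕ}
    (hcard : Nat.card G = p ^ (m + 3)) (hnc : ¬ IsCyclic G)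
    (h : Nat.card (Subgroup G) = (m + 2) * (p + 1) + 2) : ∃ a : G, orderOf a = p ^ (m + 2) := by
  obtain ⟨M, hM, hMnc⟩ := exists_noncyclic_card_eq hodd hcard hnc
  have h1 := le_card_subgroup hodd hM hMnc
  obtain ⟨h2, h3⟩ := ncard_not_le_ge hcard hnc hM
  apply h3
  rw [card_subgroup_eq_add M,
    show (m + 2) * (p + 1) = (m + 1) * (p + 1) + (p + 1) by ring] at h
  omega

end Counting

section Models

theorem normal_zpowers_of_closure_pair {G : Type*} [Group G] {a y : G}
    (hcl : closure {a, y} = ⊤) (h₁ : y * a * y⁻¹ ∈ zpowers a) (h₂ : y⁻¹ * a * y ∈ zpowers a) :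
    (zpowers a).Normal := by
  rw [← normalizer_eq_top_iff, eq_top_iff, ← hcl, closure_le]
  have hconj : ∀ g : G, g * a * g⁻¹ ∈ zpowers a → ∀ h ∈ zpowers a, g * h * g⁻¹ ∈ zpowers a := by
    rintro g hg _ ⟨k, rfl⟩
    change g * a ^ k * g⁻¹ ∈ _
    rw [← conj_zpow]
    exact zpow_mem hg k
  rintro g (rfl | rfl)
  · exact le_normalizer (mem_zpowers g)
  · refine mem_normalizer_iff.2 fun h => ⟨hconj g h₁ h, fun hh => ?_⟩
    have := hconj g⁻¹ (by simpa using h₂) _ hh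
    rwa [show g⁻¹ * (g * h * g⁻¹) * g⁻¹⁻¹ = h by group] at this

theorem card_eq_of_closure_pair {G : Type*} [Group G] {p : ℕ} [Fact p.Prime] {a y : G}
    (hcl : closure {a, y} = ⊤) (hn : (zpowers a).Normal) (hy : y ^ p = 1)
    (hya : y ∉ zpowers a) : Nat.card G = orderOf a * p := by
  rw [← (zpowers a).card_mul_index, Nat.card_zpowers]
  congr 1
  have htop : zpowers (y : G ⧸ zpowers a) = ⊤ := by
    have h1 := map_top_of_surjective _ (QuotientGroup.mk'_surjective (zpowers a))
    rw [← h1, ← hcl, MonoidHom.map_closure, Set.image_pair]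
    have ha : (QuotientGroup.mk' (zpowers a)) a = 1 :=
      (QuotientGroup.eq_one_iff a).2 (mem_zpowers a)
    rw [ha, closure_insert_one, ← zpowers_eq_closure]
    rfl
  rw [Subgroup.index, ← card_top, ← htop, Nat.card_zpowers]
  refine orderOf_eq_prime ?_ ((QuotientGroup.eq_one_iff y).not.2 hya)
  rw [← QuotientGroup.mk_pow, hy, QuotientGroup.mk_one]

variable {p m : ℕ}

theorem card_zmod_prod :
    Nat.card (Multiplicative (ZMod p) × Multiplicative (ZMod (p ^ (m + 2)))) = p ^ (m + 3) := by
  rw [Nat.card_prod, Nat.card_congr Multiplicative.toAdd, Nat.card_congr Multiplicative.toAdd,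
    Nat.card_zmod, Nat.card_zmod]
  ring

theorem multiplicative_zmod_pow_eq_one {k l : ℕ} (h : k ∣ l) (x : Multiplicative (ZMod k)) :
    x ^ l = 1 := by
  rw [← orderOf_dvd_iff_pow_eq_one]
  refine (orderOf_dvd_natCard x).trans ?_
  rwa [Nat.card_congr Multiplicative.toAdd, Nat.card_zmod]

theorem addRight_one_pow {R : Type*} [Ring R] (k : ℕ) :
    (Equiv.addRight 1 : Equiv.Perm R) ^ k = Equiv.addRight (k : R) := by
  induction k with
  | zero => ext; simp
  | succ k ih => ext t; simp [pow_succ, ih, add_comm (k : R), add_assoc]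

namespace ModularGroup

/-- The generator `x` of `M(p^n)`. -/
def genX (p n : ℕ) : ModularGroup p n := PresentedGroup.of (rels := modularRels p n) 0

/-- The generator `y` of `M(p^n)`. -/
def genY (p n : ℕ) : ModularGroup p n := PresentedGroup.of (rels := modularRels p n) 1

theorem genX_pow (p n : ℕ) : genX p n ^ p ^ (n - 1) = 1 :=
  PresentedGroup.one_of_mem (rels := modularRels p n) (by simp [modularRels])

theorem genY_pow (p n : ℕ) : genY p n ^ p = 1 :=
  PresentedGroup.one_of_mem (rels := modularRels p n) (x := FreeGroup.of 1 ^ p)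
    (by simp [modularRels])

theorem conj_genX (p n : ℕ) :
    (genY p n)⁻¹ * genX p n * genY p n = genX p n ^ (1 + p ^ (n - 2)) := by
  rw [← mul_inv_eq_one]
  exact PresentedGroup.one_of_mem (rels := modularRels p n)
    (x := (FreeGroup.of 1)⁻¹ * FreeGroup.of 0 * FreeGroup.of 1 *
      (FreeGroup.of 0 ^ (1 + p ^ (n - 2)))⁻¹) (by simp [modularRels])

theorem closure_gens (p n : ℕ) : closure {genX p n, genY p n} = ⊤ := by
  refine Eq.trans ?_ (PresentedGroup.closure_range_of (modularRels p n))
  congr 1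
  ext g
  constructor
  · rintro (rfl | rfl)
    · exact ⟨0, rfl⟩
    · exact ⟨1, rfl⟩
  · rintro ⟨i, rfl⟩
    fin_cases i
    · exact Or.inl rfl
    · exact Or.inr rfl

theorem exists_hom {H : Type*} [Group H] {n : ℕ} {a y : H} (ha : a ^ p ^ (n - 1) = 1)
    (hy : y ^ p = 1) (hay : y⁻¹ * a * y = a ^ (1 + p ^ (n - 2))) :
    ∃ f : ModularGroup p n →* H, f (genX p n) = a ∧ f (genY p n) = y := by
  have hrel : ∀ r ∈ modularRels p n, FreeGroup.lift ![a, y] r = 1 := by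
    rintro r (rfl | rfl | rfl)
    · simpa using ha
    · simpa using hy
    · simp [hay]
  refine ⟨PresentedGroup.toGroup hrel, ?_, ?_⟩
  · exact (PresentedGroup.toGroup.of hrel).trans rfl
  · exact (PresentedGroup.toGroup.of hrel).trans rfl

/-- `M(p^n)` acts on `ℤ / p ^ (n - 1)` with `x` acting as the translation by `1`. -/
theorem exists_hom_perm (p m : ℕ) : ∃ f : ModularGroup p (m + 3) →* Equiv.Perm (ZMod (p ^ (m + 2))),
    f (genX p (m + 3)) = Equiv.addRight 1 := by
  set q : ZMod (p ^ (m + 2)) := ((p ^ (m + 1) : ℕ) : ZMod (p ^ (m + 2))) with hq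
  have hqq : q * q = 0 := by
    rw [hq, ← Nat.cast_mul, ZMod.natCast_eq_zero_iff]
    exact ⟨p ^ m, by ring⟩
  have hpq : (p : ZMod (p ^ (m + 2))) * q = 0 := by
    rw [hq, ← Nat.cast_mul, ZMod.natCast_eq_zero_iff]
    exact ⟨1, by ring⟩
  let u : (ZMod (p ^ (m + 2)))ˣ :=
    ⟨1 - q, 1 + q, by linear_combination -hqq, by linear_combination -hqq⟩
  have hu : u ^ p = 1 := by
    have : ∀ i : ℕ, (1 - q) ^ i = 1 - i * q := by
      intro i
      induction i with
      | zero => simp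
      | succ i ih =>
        rw [pow_succ (1 - q), ih]
        push_cast
        linear_combination (i : ZMod (p ^ (m + 2))) * hqq
    ext
    rw [Units.val_pow_eq_pow_val, this, hpq]
    simp
  obtain ⟨f, hf, -⟩ := exists_hom (p := p) (n := m + 3)
    (a := (Equiv.addRight 1 : Equiv.Perm (ZMod (p ^ (m + 2))))) (y := Units.mulLeft u)
    (by
      rw [addRight_one_pow]
      ext t
      simp)
    (by
      have : ∀ i : ℕ, (Units.mulLeft u : Equiv.Perm _) ^ i = Units.mulLeft (u ^ i) := by
        intro i
        induction i with
        | zero => ext; simp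
        | succ i ih => ext t; simp [pow_succ, ih, mul_assoc]
      rw [this, hu]
      ext; simp)
    (by
      rw [addRight_one_pow, mul_assoc, inv_mul_eq_iff_eq_mul]
      ext t
      have h1 : ((1 + p ^ (m + 3 - 2) : ℕ) : ZMod (p ^ (m + 2))) = 1 + q := by
        rw [hq]; push_cast; rfl
      have h2 : (u : ZMod (p ^ (m + 2))) = 1 - q := rfl
      simp only [Equiv.Perm.mul_apply, Units.mulLeft_apply, Equiv.coe_addRight, h1, h2]
      linear_combination hqq)
  exact ⟨f, hf⟩

theorem orderOf_genX : orderOf (genX p (m + 3)) = p ^ (m + 2) := by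
  apply Nat.dvd_antisymm (orderOf_dvd_iff_pow_eq_one.2 (genX_pow p (m + 3)))
  obtain ⟨f, hf⟩ := exists_hom_perm p m
  refine dvd_trans ?_ (orderOf_map_dvd f _)
  rw [hf, ← ZMod.natCast_eq_zero_iff]
  have h := pow_orderOf_eq_one (Equiv.addRight 1 : Equiv.Perm (ZMod (p ^ (m + 2))))
  rw [addRight_one_pow] at h
  simpa using Equiv.congr_fun h 0

variable [hp : Fact p.Prime]

theorem not_commute_gens : ¬ Commute (genX p (m + 3)) (genY p (m + 3)) := by
  intro h
  have h1 := conj_genX p (m + 3)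
  rw [mul_assoc, h.eq, inv_mul_cancel_left, pow_add, pow_one, left_eq_mul,
    ← orderOf_dvd_iff_pow_eq_one, orderOf_genX, Nat.pow_dvd_pow_iff_le_right hp.out.one_lt] at h1
  omega

theorem not_isCyclic : ¬ IsCyclic (ModularGroup p (m + 3)) := fun _ =>
  not_commute_gens (p := p) (m := m)
    ((IsCyclic.commGroup (α := ModularGroup p (m + 3))).mul_comm _ _)

theorem genY_notMem : genY p (m + 3) ∉ zpowers (genX p (m + 3)) := by
  rintro ⟨k, hk⟩
  refine not_commute_gens (p := p) (m := m) ?_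
  rw [← hk]
  exact Commute.self_zpow _ k

theorem card_eq : Nat.card (ModularGroup p (m + 3)) = p ^ (m + 3) := by
  have h₂ : (genY p (m + 3))⁻¹ * genX p (m + 3) * genY p (m + 3) ∈ zpowers (genX p (m + 3)) := by
    rw [conj_genX]; exact pow_mem (mem_zpowers _) _
  have h₁ : genY p (m + 3) * genX p (m + 3) * (genY p (m + 3))⁻¹ ∈ zpowers (genX p (m + 3)) := by
    obtain ⟨k, hk⟩ := mem_zpowers_iff.1 h₂
    have h := conj_pow_eq_zpow (g := (genY p (m + 3))⁻¹) (by rw [inv_inv]; exact hk.symm) (p - 1)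
    have hinv : (genY p (m + 3))⁻¹ ^ (p - 1) = genY p (m + 3) := by
      rw [inv_pow, inv_eq_iff_mul_eq_one, ← pow_succ, Nat.sub_add_cancel hp.out.one_le, genY_pow]
    rw [hinv] at h
    rw [h]
    exact zpow_mem (mem_zpowers _) _
  rw [card_eq_of_closure_pair (closure_gens p (m + 3))
    (normal_zpowers_of_closure_pair (closure_gens p (m + 3)) h₁ h₂) (genY_pow p (m + 3))
    genY_notMem, orderOf_genX]
  ring

end ModularGroup

theorem not_isCyclic_zmod_prod [hp : Fact p.Prime] :
    ¬ IsCyclic (Multiplicative (ZMod p) × Multiplicative (ZMod (p ^ (m + 2)))) := by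
  intro h
  obtain ⟨g, hg⟩ := h.exists_ofOrder_eq_natCard
  have h1 : g ^ p ^ (m + 2) = 1 :=
    Prod.ext (multiplicative_zmod_pow_eq_one (dvd_pow_self _ (by omega)) g.1)
      (multiplicative_zmod_pow_eq_one dvd_rfl g.2)
  rw [← orderOf_dvd_iff_pow_eq_one, hg, card_zmod_prod,
    Nat.pow_dvd_pow_iff_le_right hp.out.one_lt] at h1
  omega

theorem exists_orderOf_zmod_prod :
    ∃ a : Multiplicative (ZMod p) × Multiplicative (ZMod (p ^ (m + 2))),
      orderOf a = p ^ (m + 2) := by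
  refine ⟨(1, Multiplicative.ofAdd 1), ?_⟩
  rw [Prod.orderOf_mk, orderOf_one, Nat.lcm_one_left, orderOf_ofAdd_eq_addOrderOf,
    ZMod.addOrderOf_one]

end Models

section Classification

variable {G : Type*} [Group G] {p m : ℕ} [hp : Fact p.Prime]

theorem closure_pair_eq_top [Finite G] (hcard : Nat.card G = p ^ (m + 3)) {a y : G}
    (ha : orderOf a = p ^ (m + 2)) (hy : y ∉ zpowers a) : closure {a, y} = ⊤ := by
  obtain ⟨k, hk, hk'⟩ := (Nat.dvd_prime_pow hp.out).1
    (hcard ▸ (closure {a, y}).card_subgroup_dvd_card)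
  have hle : zpowers a ≤ closure {a, y} := by
    rw [zpowers_le]; exact subset_closure (by simp)
  rw [← card_eq_iff_eq_top, hk', hcard]
  congr 1
  by_contra hne
  have : zpowers a = closure {a, y} := by
    apply eq_of_le_of_card_ge hle
    rw [Nat.card_zpowers, ha, hk']
    exact Nat.pow_le_pow_right hp.out.pos (by omega)
  exact hy (this ▸ subset_closure (by simp))

theorem nonempty_mulEquiv_of_hom {H : Type*} [Group H] [Finite G] (hG : Nat.card G = Nat.card H)
    {a y : G} (hcl : closure {a, y} = ⊤) (f : H →* G) (ha : a ∈ f.range) (hy : y ∈ f.range) :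
    Nonempty (G ≃* H) := by
  have : Finite H := Nat.finite_of_card_ne_zero (hG ▸ Nat.card_pos.ne')
  have hsurj : Function.Surjective f := by
    rw [← MonoidHom.range_eq_top, eq_top_iff, ← hcl, closure_le]
    rintro g (rfl | rfl)
    · exact ha
    · exact hy
  exact ⟨(MulEquiv.ofBijective f
    ((Nat.bijective_iff_surjective_and_card f).2 ⟨hsurj, hG.symm⟩)).symm⟩

theorem exists_zmod_hom {k : ℕ} {g : G} (hg : g ^ k = 1) :
    ∃ f : Multiplicative (ZMod k) →* G, f.range = zpowers g := by
  let φ : ZMod k →+ Additive G := ZMod.lift k ⟨zmultiplesHom (Additive G) (Additive.ofMul g), by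
    simp [← ofMul_pow, hg]⟩
  refine ⟨φ.toMultiplicativeLeft, ?_⟩
  have hφ : ∀ i : ℤ, φ.toMultiplicativeLeft (Multiplicative.ofAdd (i : ZMod k)) = g ^ i := by
    intro i
    simp [φ]
  ext x
  rw [mem_zpowers_iff]
  constructor
  · rintro ⟨t, rfl⟩
    obtain ⟨i, hi⟩ := ZMod.intCast_surjective t.toAdd
    exact ⟨i, by rw [← hφ, hi]; rfl⟩
  · rintro ⟨i, rfl⟩
    exact ⟨_, hφ i⟩

theorem nonempty_mulEquiv_of_orderOf [Finite G] (hodd : Odd p) (hcard : Nat.card G = p ^ (m + 3))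
    (hnc : ¬ IsCyclic G) {a : G} (ha : orderOf a = p ^ (m + 2)) :
    Nonempty (G ≃* Multiplicative (ZMod p) × Multiplicative (ZMod (p ^ (m + 2)))) ∨
      Nonempty (G ≃* ModularGroup p (m + 3)) := by
  obtain ⟨y, hya, hyp⟩ := exists_pow_eq_one_notMem_zpowers hodd hcard hnc ha
  have hapow : a ^ p ^ (m + 2) = 1 := by rw [← ha, pow_orderOf_eq_one]
  set z := a ^ p ^ (m + 1) with hz
  have hzp : z ^ p = 1 := by rw [hz, ← pow_mul, ← pow_succ, hapow]
  have hz1 : z ≠ 1 := by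
    intro h
    rw [hz, ← orderOf_dvd_iff_pow_eq_one, ha, Nat.pow_dvd_pow_iff_le_right hp.out.one_lt] at h
    omega
  have hzc : ∀ g, Commute z g := fun g =>
    (mem_center_iff.1 (pow_mem_center_of_orderOf hodd hcard ha) g).symm
  obtain ⟨j, hj⟩ := mem_zpowers_iff.1 (commutator_mem_zpowers hodd hcard ha y⁻¹ a)
  have hconj : y⁻¹ * a * y = z ^ j * a := by
    rw [hz, hj, commutatorElement_def]; group
  by_cases hpj : (p : ℤ) ∣ j
  · left
    obtain ⟨s, rfl⟩ := hpj
    rw [zpow_mul, zpow_natCast, hzp, one_zpow, one_mul, mul_assoc, inv_mul_eq_iff_eq_mul] at hconj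
    obtain ⟨f, hf⟩ := exists_zmod_hom hyp
    obtain ⟨g, hg⟩ := exists_zmod_hom hapow
    have hcomm : ∀ s t, Commute (f s) (g t) := by
      intro s t
      obtain ⟨k, hk⟩ : f s ∈ zpowers y := hf ▸ ⟨s, rfl⟩
      obtain ⟨l, hl⟩ : g t ∈ zpowers a := hg ▸ ⟨t, rfl⟩
      rw [← hk, ← hl]
      exact Commute.zpow_zpow hconj.symm k l
    refine nonempty_mulEquiv_of_hom (hcard.trans card_zmod_prod.symm)
      (closure_pair_eq_top hcard ha hya) (f.noncommCoprod g hcomm) ?_ ?_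
    · obtain ⟨t, ht⟩ : a ∈ g.range := hg ▸ mem_zpowers a
      exact ⟨(1, t), by simp [ht]⟩
    · obtain ⟨t, ht⟩ : y ∈ f.range := hf ▸ mem_zpowers y
      exact ⟨(t, 1), by simp [ht]⟩
  · right
    obtain ⟨i, hi⟩ : ∃ i : ℕ, (p : ℤ) ∣ j * i - 1 := by
      refine ⟨((j : ZMod p)⁻¹).val, ?_⟩
      rw [← ZMod.intCast_zmod_eq_zero_iff_dvd]
      have : (j : ZMod p) ≠ 0 := by rwa [Ne, ZMod.intCast_zmod_eq_zero_iff_dvd]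
      simp [this]
    have hconji : ∀ i : ℕ, (y ^ i)⁻¹ * a * y ^ i = z ^ (j * i) * a := by
      intro i
      induction i with
      | zero => simp
      | succ i ih =>
        calc (y ^ (i + 1))⁻¹ * a * y ^ (i + 1) = y⁻¹ * ((y ^ i)⁻¹ * a * y ^ i) * y := by
              rw [pow_succ]; group
          _ = y⁻¹ * z ^ (j * i) * a * y := by rw [ih]; group
          _ = z ^ (j * i) * (y⁻¹ * a * y) := by
              rw [((hzc y⁻¹).zpow_left _).symm.eq]; group
          _ = z ^ (j * (i + 1 : ℕ)) * a := by
              rw [hconj, ← mul_assoc, ← zpow_add]; push_cast; ring_nf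
    have hw : (y ^ i)⁻¹ * a * y ^ i = z * a := by
      obtain ⟨s, hs⟩ := hi
      rw [hconji, show j * i = p * s + 1 by linarith, zpow_add_one, zpow_mul, zpow_natCast, hzp,
        one_zpow, one_mul]
    have hyia : y ^ i ∉ zpowers a := by
      rintro ⟨k, hk⟩
      have hk' : a ^ k = y ^ i := hk
      rw [← hk', mul_assoc, (Commute.self_zpow a k).eq, inv_mul_cancel_left, right_eq_mul] at hw
      exact hz1 hw
    obtain ⟨f, hfx, hfy⟩ := ModularGroup.exists_hom (p := p) (n := m + 3) (a := a) (y := y ^ i)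
      hapow (by rw [← pow_mul, mul_comm, pow_mul, hyp, one_pow])
      (by rw [hw, (hzc a).eq, pow_add, pow_one]; rfl)
    exact nonempty_mulEquiv_of_hom (hcard.trans ModularGroup.card_eq.symm)
      (closure_pair_eq_top hcard ha hyia) f ⟨_, hfx⟩ ⟨_, hfy⟩

theorem beta_eq_iff (hcard : Nat.card G = p ^ (m + 3)) :
    beta G = ((((m + 3 : ℕ) : ℝ) - 1) * ((p : ℝ) + 1) + 2) / (p : ℝ) ^ (m + 3) ↔
      Nat.card (Subgroup G) = (m + 2) * (p + 1) + 2 := by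
  have hp0 : (p : ℝ) ^ (m + 3) ≠ 0 := pow_ne_zero _ (by exact_mod_cast hp.out.ne_zero)
  rw [beta, hcard, Nat.cast_pow, div_left_inj' hp0, ← Nat.cast_inj (R := ℝ)]
  push_cast
  rw [show (m : ℝ) + 3 - 1 = m + 2 by ring]

theorem le_beta_iff (hcard : Nat.card G = p ^ (m + 3)) :
    ((((m + 3 : ℕ) : ℝ) - 1) * ((p : ℝ) + 1) + 2) / (p : ℝ) ^ (m + 3) ≤ beta G ↔
      (m + 2) * (p + 1) + 2 ≤ Nat.card (Subgroup G) := by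
  have hp0 : 0 < (p : ℝ) ^ (m + 3) := pow_pos (by exact_mod_cast hp.out.pos) _
  rw [beta, hcard, Nat.cast_pow, div_le_div_iff_of_pos_right hp0, ← Nat.cast_le (α := ℝ)]
  push_cast
  rw [show (m : ℝ) + 3 - 1 = m + 2 by ring]

end Classification

theorem stmt_3 (p n : ℕ) (hp : p.Prime) (hodd : Odd p) (hn : 3 ≤ n)
    (G : Type) [Group G] [Finite G]
    (hcard : Nat.card G = p ^ n) (hnc : ¬ IsCyclic G) :
    beta (Multiplicative (ZMod p) × Multiplicative (ZMod (p ^ (n - 1))))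
      = (((n : ℝ) - 1) * ((p : ℝ) + 1) + 2) / (p : ℝ) ^ n ∧
    beta (ModularGroup p n) = (((n : ℝ) - 1) * ((p : ℝ) + 1) + 2) / (p : ℝ) ^ n ∧
    beta G ≥ (((n : ℝ) - 1) * ((p : ℝ) + 1) + 2) / (p : ℝ) ^ n ∧
    (beta G = (((n : ℝ) - 1) * ((p : ℝ) + 1) + 2) / (p : ℝ) ^ n ↔
      (Nonempty (G ≃* Multiplicative (ZMod p) × Multiplicative (ZMod (p ^ (n - 1)))) ∨
       Nonempty (G ≃* ModularGroup p n))) := by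
  have := Fact.mk hp
  obtain ⟨m, rfl⟩ : ∃ m, n = m + 3 := ⟨n - 3, by omega⟩
  have : Finite (ModularGroup p (m + 3)) :=
    Nat.finite_of_card_ne_zero (by rw [ModularGroup.card_eq]; exact pow_ne_zero _ hp.ne_zero)
  rw [show m + 3 - 1 = m + 2 from rfl, ge_iff_le, le_beta_iff hcard, beta_eq_iff hcard,
    beta_eq_iff card_zmod_prod, beta_eq_iff ModularGroup.card_eq]
  obtain ⟨b, hb⟩ := exists_orderOf_zmod_prod (p := p) (m := m)
  refine ⟨card_subgroup_of_cyclic_maximal hodd card_zmod_prod not_isCyclic_zmod_prod hb,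
    card_subgroup_of_cyclic_maximal hodd ModularGroup.card_eq ModularGroup.not_isCyclic
      ModularGroup.orderOf_genX,
    le_card_subgroup hodd hcard hnc, fun h => ?_, ?_⟩
  · obtain ⟨a, ha⟩ := exists_orderOf_of_card_subgroup_eq hodd hcard hnc h
    exact nonempty_mulEquiv_of_orderOf hodd hcard hnc ha
  · rintro (⟨⟨e⟩⟩ | ⟨⟨e⟩⟩)
    · exact card_subgroup_of_cyclic_maximal hodd hcard hnc
        ((e.symm.orderOf_eq b).trans hb)
    · exact card_subgroup_of_cyclic_maximal hodd hcard hnc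
        ((e.symm.orderOf_eq _).trans ModularGroup.orderOf_genX)
end

section
/- Let G be a group of order 8 that is not cyclic. Then β(G) ≥ β(Q_8) = 3/4, and equality holds if and only if G is isomorphic to the quaternion group Q_8. -/
theorem pow_four_eq_one_of_card_eight {G : Type*} [Group G] [Finite G]
    (hcard : Nat.card G = 8) (hnc : ¬ IsCyclic G) (g : G) : g ^ 4 = 1 := by
  have hdvd : orderOf g ∣ 2 ^ 3 := by
    simpa [hcard] using orderOf_dvd_natCard g
  obtain ⟨k, hk, hg⟩ := (Nat.dvd_prime_pow Nat.prime_two).1 hdvd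
  have hk3 : k ≠ 3 := by
    rintro rfl
    exact hnc (isCyclic_of_orderOf_eq_card g (by rw [hg, hcard]; norm_num))
  apply orderOf_dvd_iff_pow_eq_one.1
  rw [hg]
  exact pow_dvd_pow 2 (by omega : k ≤ 2)

theorem eq_or_eq_inv_of_zpowers_eq {G : Type*} [Group G] {g h : G} (hg : g ^ 4 = 1)
    (hgh : Subgroup.zpowers h = Subgroup.zpowers g) : h = g ∨ h = g⁻¹ := by
  have hinv : g⁻¹ = g ^ 3 := inv_eq_of_mul_eq_one_right (by rw [← pow_succ', hg])
  have hmem : h ∈ Subgroup.zpowers g := hgh ▸ Subgroup.mem_zpowers h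
  have hmem' : g ∈ Subgroup.zpowers h := hgh ▸ Subgroup.mem_zpowers g
  have hfin : IsOfFinOrder g := isOfFinOrder_iff_pow_eq_one.2 ⟨4, by norm_num, hg⟩
  obtain ⟨n, hn⟩ := hfin.mem_powers_iff_mem_zpowers.2 hmem
  have hn' : g ^ (n % 4) = h := by rw [← pow_eq_pow_mod n hg]; exact hn
  have hlt : n % 4 < 4 := Nat.mod_lt _ (by norm_num)
  generalize n % 4 = m at hn' hlt
  interval_cases m
  · left
    rw [pow_zero] at hn'
    subst hn'
    rw [Subgroup.zpowers_one_eq_bot, Subgroup.mem_bot] at hmem'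
    exact hmem'.symm
  · left
    simpa using hn'.symm
  · have hh : h ^ 2 = 1 := by rw [← hn', ← pow_mul, hg]
    obtain ⟨k, hk⟩ := Subgroup.mem_zpowers_iff.1 hmem'
    have hg2 : g ^ 2 = 1 := by
      rw [← hk, ← zpow_natCast, ← zpow_mul, mul_comm, zpow_mul, zpow_natCast, hh, one_zpow]
    left
    rw [← hk, ← hn', hg2, one_zpow]
  · right
    rw [hinv, hn']

/-- Two distinct involutions in a noncyclic group of order 8 force at least seven subgroups: the
whole group and at least six cyclic ones. -/
theorem seven_le_card_subgroup_of_two_involutions {G : Type*} [Group G] [Finite G]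
    (hcard : Nat.card G = 8) (hnc : ¬ IsCyclic G) {u v : G} (hu : u ^ 2 = 1) (hv : v ^ 2 = 1)
    (hu1 : u ≠ 1) (hv1 : v ≠ 1) (huv : u ≠ v) : 7 ≤ Nat.card (Subgroup G) := by
  classical
  have := Fintype.ofFinite G
  have := Fintype.ofFinite (Subgroup G)
  rw [Nat.card_eq_fintype_card] at hcard ⊢
  have hpow (g : G) : g ^ 4 = 1 :=
    pow_four_eq_one_of_card_eight (by rwa [Nat.card_eq_fintype_card]) hnc g
  let S : Finset G := Finset.univ.filter fun g => g ^ 2 = 1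
  let T : Finset G := Finset.univ.filter fun g => ¬ g ^ 2 = 1
  have hST : S.card + T.card = 8 := by
    rw [Finset.card_filter_add_card_filter_not, Finset.card_univ, hcard]
  have hS : 3 ≤ S.card := by
    rw [← Finset.card_eq_three.2 ⟨1, u, v, hu1.symm, hv1.symm, huv, rfl⟩]
    refine Finset.card_le_card fun g hg => ?_
    simp only [Finset.mem_insert, Finset.mem_singleton] at hg
    rcases hg with rfl | rfl | rfl <;> simp [S, hu, hv]
  have hSimage : (S.image Subgroup.zpowers).card = S.card := by
    refine Finset.card_image_of_injOn fun g hg h hh hgh => ?_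
    simp only [S, Finset.coe_filter, Finset.mem_univ, true_and, Set.mem_ofPred_eq] at hg hh
    rcases eq_or_eq_inv_of_zpowers_eq (hpow h) hgh with e | e
    · exact e
    · rw [e]
      exact inv_eq_of_mul_eq_one_right (by rw [← sq, hh])
  have hTimage : T.card ≤ 2 * (T.image Subgroup.zpowers).card := by
    refine Finset.card_le_mul_card_image T 2 fun H hH => ?_
    obtain ⟨g, -, rfl⟩ := Finset.mem_image.1 hH
    refine (Finset.card_le_card fun h hh => ?_).trans (Finset.card_le_two (a := g) (b := g⁻¹))
    simpa using eq_or_eq_inv_of_zpowers_eq (hpow g) (Finset.mem_filter.1 hh).2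
  have hdisj : Disjoint (S.image Subgroup.zpowers) (T.image Subgroup.zpowers) := by
    rw [Finset.disjoint_left]
    intro H hHS hHT
    obtain ⟨g, hg, rfl⟩ := Finset.mem_image.1 hHS
    obtain ⟨h, hh, hgh⟩ := Finset.mem_image.1 hHT
    simp only [S, T, Finset.mem_filter, Finset.mem_univ, true_and] at hg hh
    rcases eq_or_eq_inv_of_zpowers_eq (hpow g) hgh with rfl | rfl
    · exact hh hg
    · exact hh (by rw [inv_pow, hg, inv_one])
  have htop : ⊤ ∉ S.image Subgroup.zpowers ∪ T.image Subgroup.zpowers := by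
    rw [← Finset.image_union, Finset.mem_image]
    rintro ⟨g, -, hg⟩
    exact hnc ⟨g, fun x => (hg ▸ Subgroup.mem_top x : x ∈ Subgroup.zpowers g)⟩
  have hle := Finset.card_le_univ (insert ⊤ (S.image Subgroup.zpowers ∪ T.image Subgroup.zpowers))
  rw [Finset.card_insert_of_notMem htop, Finset.card_union_of_disjoint hdisj, hSimage] at hle
  omega

/-- The standard presentation of `Q₈`: a homomorphism is given by `x`, `y` with
`x ^ 4 = 1`, `y ^ 2 = x ^ 2` and `x * y = y * x ^ 3`. -/
def quaternionGroupTwoLift {G : Type*} [Group G] (x y : G) (hx : x ^ 4 = 1)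
    (hy : y ^ 2 = x ^ 2) (hxy : x * y = y * x ^ 3) : QuaternionGroup 2 →* G :=
  MonoidHom.mk'
    (fun q => match q with
      | .a i => x ^ (ZMod.val (n := 4) i)
      | .xa i => y * x ^ (ZMod.val (n := 4) i))
    (by
      have hmod {m n : ℕ} (h : m % 4 = n % 4) : x ^ m = x ^ n := by
        rw [pow_eq_pow_mod m hx, h, ← pow_eq_pow_mod n hx]
      have hcomm (i : ℕ) : x ^ i * y = y * x ^ (3 * i) := by
        have h : SemiconjBy y (x ^ 3) x := hxy.symm
        rw [pow_mul]
        exact (h.pow_right i).eq.symm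
      have hadd : ∀ i j : ZMod 4, (i + j).val % 4 = (i.val + j.val) % 4 := by decide
      have hsub : ∀ i j : ZMod 4, (j - i).val % 4 = (3 * i.val + j.val) % 4 := by decide
      have hsub' : ∀ i j : ZMod 4,
          (((2 : ℕ) : ZMod 4) + j - i).val % 4 = (2 + (3 * i.val + j.val)) % 4 := by decide
      rintro (i | i) (j | j)
      · simp only [QuaternionGroup.a_mul_a]
        rw [← pow_add]
        exact hmod (hadd i j)
      · simp only [QuaternionGroup.a_mul_xa]
        rw [← mul_assoc, hcomm, mul_assoc, ← pow_add]
        exact congrArg (y * ·) (hmod (hsub i j))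
      · simp only [QuaternionGroup.xa_mul_a]
        rw [mul_assoc, ← pow_add]
        exact congrArg (y * ·) (hmod (hadd i j))
      · simp only [QuaternionGroup.xa_mul_xa]
        rw [mul_assoc, ← mul_assoc _ y, hcomm, mul_assoc, ← pow_add, ← mul_assoc, ← pow_two y, hy,
          ← pow_add]
        exact hmod (hsub' i j))

theorem nonempty_mulEquiv_quaternionGroup_two {G : Type*} [Group G] [Finite G]
    (hcard : Nat.card G = 8) (hnc : ¬ IsCyclic G)
    (huniq : ∀ u v : G, u ^ 2 = 1 → v ^ 2 = 1 → u ≠ 1 → v ≠ 1 → u = v) :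
    Nonempty (G ≃* QuaternionGroup 2) := by
  have hpow := pow_four_eq_one_of_card_eight hcard hnc
  have hex : ∃ x : G, x ^ 2 ≠ 1 := by
    by_contra! h
    have := Fintype.ofFinite G
    rw [Nat.card_eq_fintype_card] at hcard
    have : Fintype.card G ≤ 2 := by
      by_contra! hlt
      obtain ⟨u, v, w, huv, huw, hvw⟩ := Fintype.two_lt_card_iff.1 hlt
      by_cases hu : u = 1
      · exact hvw (huniq v w (h v) (h w) (hu ▸ huv.symm) (hu ▸ huw.symm))
      by_cases hv : v = 1
      · exact huw (huniq u w (h u) (h w) hu (hv ▸ hvw.symm))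
      · exact huv (huniq u v (h u) (h v) hu hv)
    omega
  obtain ⟨x, hx⟩ := hex
  have hx4 := hpow x
  have hsq {g : G} (hg : g ≠ 1) (hgx : g ≠ x ^ 2) : g ^ 2 = x ^ 2 := by
    have hg2 : g ^ 2 ≠ 1 := fun h => hgx (huniq g (x ^ 2) h (by rw [← pow_mul, hx4]) hg hx)
    exact huniq _ _ (by rw [← pow_mul, hpow]) (by rw [← pow_mul, hx4]) hg2 hx
  have hnot : ∃ y : G, y ∉ Subgroup.zpowers x := by
    by_contra! h
    exact hnc ⟨x, h⟩
  obtain ⟨y, hy⟩ := hnot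
  have hypow (n : ℕ) : y ≠ x ^ n := fun h => hy (h ▸ Subgroup.npow_mem_zpowers x n)
  have hy2 : y ^ 2 = x ^ 2 := hsq (by simpa using hypow 0) (hypow 2)
  have hyx : (y * x) ^ 2 = x ^ 2 := by
    refine hsq (fun h => hy ?_) (fun h => hypow 1 ?_)
    · rw [eq_inv_of_mul_eq_one_left h]
      exact inv_mem (Subgroup.mem_zpowers x)
    · rw [sq] at h
      simpa using mul_right_cancel h
  have hxy : x * y = y * x ^ 3 := by
    have h1 : x * y * x = y := by
      rw [← hy2, sq, sq, mul_assoc] at hyx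
      simpa [mul_assoc] using mul_left_cancel hyx
    calc x * y = x * y * x ^ 4 := by rw [hx4, mul_one]
      _ = x * y * x * x ^ 3 := by rw [pow_succ' x 3]; simp only [mul_assoc]
      _ = y * x ^ 3 := by rw [h1]
  have hinj : Function.Injective (quaternionGroupTwoLift x y hx4 hy2 hxy) := by
    rw [injective_iff_map_eq_one]
    rintro (i | i) hi
    · have hi' : x ^ (ZMod.val (n := 4) i) = 1 := hi
      have hord : orderOf x = 2 ^ (1 + 1) :=
        orderOf_eq_prime_pow (by simpa using hx) (by simpa using hx4)
      have hdvd := orderOf_dvd_of_pow_eq_one hi'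
      rw [hord] at hdvd
      have hlt := ZMod.val_lt (n := 4) i
      have h0 : ZMod.val (n := 4) i = 0 := Nat.eq_zero_of_dvd_of_lt hdvd (by simpa using hlt)
      rw [QuaternionGroup.one_def]
      exact congrArg QuaternionGroup.a ((ZMod.val_eq_zero (n := 4) i).1 h0)
    · have hi' : y * x ^ (ZMod.val (n := 4) i) = 1 := hi
      refine absurd ?_ hy
      rw [eq_inv_of_mul_eq_one_left hi']
      exact inv_mem (Subgroup.npow_mem_zpowers x _)
  have hcardQ : Nat.card (QuaternionGroup 2) = Nat.card G := by
    rw [hcard, Nat.card_eq_fintype_card, QuaternionGroup.card]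
  have hbij := (Nat.bijective_iff_injective_and_card _).2 ⟨hinj, hcardQ⟩
  exact ⟨(MulEquiv.ofBijective _ hbij).symm⟩

/-- Subgroups of a finite group correspond to finsets containing `1` and closed under division. -/
noncomputable def subgroupEquivClosedFinset (G : Type*) [Group G] [Fintype G] [DecidableEq G] :
    Subgroup G ≃ {s : Finset G // 1 ∈ s ∧ ∀ a ∈ s, ∀ b ∈ s, a * b⁻¹ ∈ s} where
  toFun H := ⟨(H : Set G).toFinite.toFinset, by simp, fun a ha b hb => by
    simp only [Set.Finite.mem_toFinset, SetLike.mem_coe] at ha hb ⊢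
    exact H.mul_mem ha (H.inv_mem hb)⟩
  invFun s := Subgroup.ofDiv (s.1 : Set G) ⟨1, s.2.1⟩ s.2.2
  left_inv H := by ext; simp [Subgroup.ofDiv]
  right_inv s := by ext; simp [Subgroup.ofDiv]

theorem card_subgroup_quaternionGroup_two : Nat.card (Subgroup (QuaternionGroup 2)) = 6 := by
  rw [Nat.card_congr (subgroupEquivClosedFinset _), Nat.card_eq_fintype_card]
  decide +kernel

theorem stmt_4 (G : Type) [Group G] [Finite G]
    (hcard : Nat.card G = 8) (hnc : ¬ IsCyclic G) :
    beta (QuaternionGroup 2) = 3 / 4 ∧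
    beta G ≥ 3 / 4 ∧
    (beta G = 3 / 4 ↔ Nonempty (G ≃* QuaternionGroup 2)) := by
  have hQ : beta (QuaternionGroup 2) = 3 / 4 := by
    rw [beta, card_subgroup_quaternionGroup_two, Nat.card_eq_fintype_card, QuaternionGroup.card]
    norm_num
  have hiso (e : G ≃* QuaternionGroup 2) : beta G = 3 / 4 := by
    rw [← hQ, beta, beta, Nat.card_congr e.toEquiv, Nat.card_congr e.mapSubgroup.toEquiv]
  refine ⟨hQ, ?_⟩
  by_cases huniq : ∀ u v : G, u ^ 2 = 1 → v ^ 2 = 1 → u ≠ 1 → v ≠ 1 → u = v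
  · have hne := nonempty_mulEquiv_quaternionGroup_two hcard hnc huniq
    have hbeta := hiso hne.some
    exact ⟨hbeta.ge, fun _ => hne, fun _ => hbeta⟩
  · push Not at huniq
    obtain ⟨u, v, hu, hv, hu1, hv1, huv⟩ := huniq
    have h7 : (7 : ℝ) ≤ Nat.card (Subgroup G) := by
      exact_mod_cast seven_le_card_subgroup_of_two_involutions hcard hnc hu hv hu1 hv1 huv
    have hlt : 3 / 4 < beta G := by
      rw [beta, hcard]
      push_cast
      linarith
    exact ⟨hlt.le, fun h => absurd h hlt.ne', fun ⟨e⟩ => hiso e⟩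
end

section
/- Let G be a group of order 16 that is not cyclic. Then β(G) ≥ 11/16 = β(Z_2 × Z_8) = β(Q_16) = β(M(16)), and equality holds if and only if G is isomorphic to Z_2 × Z_8, to the generalized quaternion group Q_16, or to the modular group M(16). -/
section CyclicExtension

variable {G K : Type*} [Group G] [Group K]

/-- `x` and `y` satisfy the defining relations of an extension of a cyclic group `⟨x⟩` by a
group of order two generated by the class of `y`. -/
structure ExtRel (x y : G) (k m : ℤ) : Prop where
  conj : y⁻¹ * x * y = x ^ k
  sq : y * y = x ^ m

/-- `G` is the group of order `16` generated by `x` of order `8` and `y ∉ ⟨x⟩`, subject to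
`y⁻¹ x y = x ^ k` and `y ^ 2 = x ^ m`. -/
structure IsExt (x y : G) (k m : ℤ) : Prop extends ExtRel x y k m where
  order : orderOf x = 8
  notMem : ∀ i : ℤ, y ≠ x ^ i
  cover : ∀ g : G, ∃ i : ℤ, g = x ^ i ∨ g = y * x ^ i

namespace ExtRel

variable {x y : G} {k m : ℤ}

theorem zpow_mul (h : ExtRel x y k m) (i : ℤ) : x ^ i * y = y * x ^ (k * i) := by
  have h1 : y⁻¹ * x ^ i * y = x ^ (k * i) := by
    rw [_root_.zpow_mul, ← h.conj]
    simpa using (conj_zpow (i := i) (a := y⁻¹) (b := x)).symm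
  rw [← h1]; group

theorem mul_mul_mul (h : ExtRel x y k m) (i j : ℤ) :
    (y * x ^ i) * (y * x ^ j) = x ^ (m + k * i + j) := by
  rw [mul_assoc, ← mul_assoc (x ^ i), h.zpow_mul, mul_assoc, ← mul_assoc, h.sq, zpow_add, zpow_add]
  simp only [mul_assoc]

/-- The subgroup consisting of the `x ^ i` with `d ∣ i` and, if `o = some j`, of the `y * x ^ i`
with `i ≡ j` modulo `d`. -/
def toSubgroup (h : ExtRel x y k m) (d : ℕ) (o : Option ℕ)
    (ho : ∀ j ∈ o, (d : ℤ) ∣ m + (k + 1) * j) : Subgroup G where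
  carrier := {g | (∃ i : ℤ, g = x ^ i ∧ (d : ℤ) ∣ i) ∨
    ∃ i : ℤ, g = y * x ^ i ∧ ∃ j ∈ o, (d : ℤ) ∣ i - j}
  one_mem' := Or.inl ⟨0, by simp⟩
  mul_mem' := by
    rintro a b (⟨i, rfl, hi⟩ | ⟨i, rfl, j, hj, hi⟩) (⟨i', rfl, hi'⟩ | ⟨i', rfl, j', hj', hi'⟩)
    · exact Or.inl ⟨i + i', by rw [zpow_add], dvd_add hi hi'⟩
    · refine Or.inr ⟨k * i + i', ?_, j', hj', ?_⟩
      · rw [← mul_assoc, h.zpow_mul, mul_assoc, zpow_add]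
      · have := dvd_add (hi.mul_left k) hi'
        rwa [← add_sub_assoc] at this
    · refine Or.inr ⟨i + i', by rw [mul_assoc, zpow_add], j, hj, ?_⟩
      have := dvd_add hi hi'
      rwa [sub_add_eq_add_sub] at this
    · refine Or.inl ⟨_, h.mul_mul_mul i i', ?_⟩
      obtain rfl := Option.mem_unique hj hj'
      have := dvd_add (dvd_add (ho j hj) (hi.mul_left k)) hi'
      ring_nf at this ⊢
      exact this
  inv_mem' := by
    rintro a (⟨i, rfl, hi⟩ | ⟨i, rfl, j, hj, hi⟩)
    · exact Or.inl ⟨-i, by rw [zpow_neg], hi.neg_right⟩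
    · refine Or.inr ⟨-k * i - m, ?_, j, hj, ?_⟩
      · rw [inv_eq_iff_mul_eq_one, h.mul_mul_mul]
        ring_nf
        simp
      · have := dvd_add (ho j hj) (hi.mul_left k)
        rw [← dvd_neg] at this
        ring_nf at this ⊢
        exact this

theorem mem_toSubgroup {h : ExtRel x y k m} {d : ℕ} {o : Option ℕ}
    {ho : ∀ j ∈ o, (d : ℤ) ∣ m + (k + 1) * j} {g : G} :
    g ∈ h.toSubgroup d o ho ↔ (∃ i : ℤ, g = x ^ i ∧ (d : ℤ) ∣ i) ∨
      ∃ i : ℤ, g = y * x ^ i ∧ ∃ j ∈ o, (d : ℤ) ∣ i - j :=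
  Iff.rfl

/-- The subgroup of all `x ^ i` and `y * x ^ i`. -/
def span (h : ExtRel x y k m) : Subgroup G :=
  h.toSubgroup 1 (some 0) (by simp)

theorem mem_span {h : ExtRel x y k m} {g : G} :
    g ∈ h.span ↔ ∃ i : ℤ, g = x ^ i ∨ g = y * x ^ i := by
  simp [span, mem_toSubgroup, exists_or]

theorem prod {x' y' : K} (h : ExtRel x y k m) (hK : ExtRel x' y' k m) :
    ExtRel (x, x') (y, y') k m where
  conj := Prod.ext h.conj hK.conj
  sq := Prod.ext h.sq hK.sq

end ExtRel

namespace IsExt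

variable {x y : G} {x' y' : K} {k m : ℤ}

theorem zpow_eq_one_iff (h : IsExt x y k m) {i : ℤ} : x ^ i = 1 ↔ 8 ∣ i := by
  rw [← orderOf_dvd_iff_zpow_eq_one, h.order]; rfl

theorem mul_zpow_ne (h : IsExt x y k m) (i j : ℤ) : y * x ^ i ≠ x ^ j := fun e =>
  h.notMem (j - i) (by rw [zpow_sub, ← e]; group)

theorem zpow_eq_zpow_iff (h : IsExt x y k m) {i j : ℤ} : x ^ i = x ^ j ↔ 8 ∣ i - j := by
  rw [← h.zpow_eq_one_iff, zpow_sub, mul_inv_eq_one]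

theorem bijective_fst (h : IsExt x y k m) (hK : IsExt x' y' k m) :
    Function.Bijective
      ((MonoidHom.fst G K).comp (h.toExtRel.prod hK.toExtRel).span.subtype) := by
  constructor
  · rw [injective_iff_map_eq_one]
    rintro ⟨⟨a, b⟩, hab⟩ (rfl : a = 1)
    obtain ⟨i, hi | hi⟩ := ExtRel.mem_span.1 hab
    · obtain ⟨h1, rfl⟩ : 1 = x ^ i ∧ b = x' ^ i := by simpa using hi
      have : x' ^ i = 1 := hK.zpow_eq_one_iff.2 (h.zpow_eq_one_iff.1 h1.symm)
      simp [this]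
    · obtain ⟨h1, -⟩ : 1 = y * x ^ i ∧ b = y' * x' ^ i := by simpa using hi
      exact absurd (h1.symm.trans (zpow_zero x).symm) (h.mul_zpow_ne i 0)
  · intro g
    obtain ⟨i, rfl | rfl⟩ := h.cover g
    · exact ⟨⟨(x, x') ^ i, ExtRel.mem_span.2 ⟨i, Or.inl rfl⟩⟩, rfl⟩
    · exact ⟨⟨(y, y') * (x, x') ^ i, ExtRel.mem_span.2 ⟨i, Or.inr rfl⟩⟩, rfl⟩

theorem bijective_snd (h : IsExt x y k m) (hK : IsExt x' y' k m) :
    Function.Bijective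
      ((MonoidHom.snd G K).comp (h.toExtRel.prod hK.toExtRel).span.subtype) := by
  constructor
  · rw [injective_iff_map_eq_one]
    rintro ⟨⟨a, b⟩, hab⟩ (rfl : b = 1)
    obtain ⟨i, hi | hi⟩ := ExtRel.mem_span.1 hab
    · obtain ⟨rfl, h1⟩ : a = x ^ i ∧ 1 = x' ^ i := by simpa using hi
      have : x ^ i = 1 := h.zpow_eq_one_iff.2 (hK.zpow_eq_one_iff.1 h1.symm)
      simp [this]
    · obtain ⟨-, h1⟩ : a = y * x ^ i ∧ 1 = y' * x' ^ i := by simpa using hi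
      exact absurd (h1.symm.trans (zpow_zero x').symm) (hK.mul_zpow_ne i 0)
  · intro g
    obtain ⟨i, rfl | rfl⟩ := hK.cover g
    · exact ⟨⟨(x, x') ^ i, ExtRel.mem_span.2 ⟨i, Or.inl rfl⟩⟩, rfl⟩
    · exact ⟨⟨(y, y') * (x, x') ^ i, ExtRel.mem_span.2 ⟨i, Or.inr rfl⟩⟩, rfl⟩

/-- The parameters `k` and `m` determine the group up to isomorphism. -/
theorem nonempty_mulEquiv (h : IsExt x y k m) (hK : IsExt x' y' k m) : Nonempty (G ≃* K) :=
  ⟨(MulEquiv.ofBijective _ (h.bijective_fst hK)).symm.trans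
    (MulEquiv.ofBijective _ (h.bijective_snd hK))⟩

/-- Replacing `y` by `y * x ^ j`. -/
theorem mul_right (h : IsExt x y k m) (j : ℤ) {m' : ℤ} (hm : 8 ∣ m + (k + 1) * j - m') :
    IsExt x (y * x ^ j) k m' where
  order := h.order
  conj := by
    have h1 : (y * x ^ j)⁻¹ * x * (y * x ^ j) = x ^ (-j) * (y⁻¹ * x * y) * x ^ j := by group
    rw [h1, h.conj]; group
  sq := by
    rw [h.mul_mul_mul, h.zpow_eq_zpow_iff]
    ring_nf at hm ⊢
    exact hm
  notMem := h.mul_zpow_ne j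
  cover g := by
    obtain ⟨i, rfl | rfl⟩ := h.cover g
    · exact ⟨i, Or.inl rfl⟩
    · exact ⟨i - j, Or.inr (by group)⟩

theorem congr (h : IsExt x y k m) {k' m' : ℤ} (hk : 8 ∣ k - k') (hm : 8 ∣ m - m') :
    IsExt x y k' m' where
  order := h.order
  conj := by rw [h.conj, h.zpow_eq_zpow_iff]; exact hk
  sq := by rw [h.sq, h.zpow_eq_zpow_iff]; exact hm
  notMem := h.notMem
  cover := h.cover

theorem card_eq (h : IsExt x y k m) : Nat.card G = 16 := by
  have hindex : (Subgroup.zpowers x).index = 2 := by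
    refine Subgroup.index_eq_two_iff'.2 ⟨y, fun g => ?_⟩
    obtain ⟨i, rfl | rfl⟩ := h.cover g
    · exact Or.inr ⟨⟨i, rfl⟩, fun ⟨j, e⟩ => h.mul_zpow_ne i j e.symm⟩
    · refine Or.inl ⟨⟨m + i, ?_⟩, fun ⟨j, e⟩ => h.mul_zpow_ne i j e.symm⟩
      rw [← mul_assoc, h.sq]
      exact zpow_add x m i
  rw [← (Subgroup.zpowers x).card_mul_index, hindex, Nat.card_zpowers, h.order]

/-- The pairs `(d, o)` that describe the subgroups of an extension, see `ExtRel.toSubgroup`. -/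
def codes (k m : ℤ) : Finset (ℕ × Option ℕ) :=
  (({1, 2, 4, 8} : Finset ℕ) ×ˢ (Finset.range 8).insertNone).filter
    fun c => ∀ j ∈ c.2, j < c.1 ∧ (c.1 : ℤ) ∣ m + (k + 1) * j

theorem dvd_of_mem_codes {c : ℕ × Option ℕ} (hc : c ∈ codes k m) : (c.1 : ℤ) ∣ 8 := by
  have h : c.1 ∈ ({1, 2, 4, 8} : Finset ℕ) :=
    (Finset.mem_product.1 (Finset.mem_filter.1 hc).1).1
  simp only [Finset.mem_insert, Finset.mem_singleton] at h
  rcases h with h | h | h | h <;> rw [h] <;> norm_num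

theorem forall_of_mem_codes {c : ℕ × Option ℕ} (hc : c ∈ codes k m) :
    ∀ j ∈ c.2, j < c.1 ∧ (c.1 : ℤ) ∣ m + (k + 1) * j :=
  (Finset.mem_filter.1 hc).2

theorem mem_codes {d : ℕ} {o : Option ℕ} (hd : d ∣ 8)
    (ho : ∀ j ∈ o, j < d ∧ (d : ℤ) ∣ m + (k + 1) * j) : (d, o) ∈ codes k m := by
  have hle : d ≤ 8 := Nat.le_of_dvd (by norm_num) hd
  refine Finset.mem_filter.2 ⟨Finset.mem_product.2 ⟨?_, ?_⟩, ho⟩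
  · have : d ∈ Nat.divisors 8 := by simpa using hd
    exact this
  · rw [Finset.mem_insertNone]
    intro j hj
    exact Finset.mem_range.2 ((ho j hj).1.trans_le hle)

theorem zpow_mem_toSubgroup (h : IsExt x y k m) {d : ℕ} {o : Option ℕ} (hd : (d : ℤ) ∣ 8)
    {ho : ∀ j ∈ o, (d : ℤ) ∣ m + (k + 1) * j} {i : ℤ} :
    x ^ i ∈ h.toSubgroup d o ho ↔ (d : ℤ) ∣ i := by
  rw [ExtRel.mem_toSubgroup]
  constructor
  · rintro (⟨i', e, hi⟩ | ⟨i', e, -⟩)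
    · have := hd.trans (h.zpow_eq_zpow_iff.1 e)
      exact (dvd_iff_dvd_of_dvd_sub this).2 hi
    · exact absurd e.symm (h.mul_zpow_ne _ _)
  · exact fun hi => Or.inl ⟨i, rfl, hi⟩

theorem mul_zpow_mem_toSubgroup (h : IsExt x y k m) {d : ℕ} {o : Option ℕ} (hd : (d : ℤ) ∣ 8)
    {ho : ∀ j ∈ o, (d : ℤ) ∣ m + (k + 1) * j} {i : ℤ} :
    y * x ^ i ∈ h.toSubgroup d o ho ↔ ∃ j ∈ o, (d : ℤ) ∣ i - j := by
  rw [ExtRel.mem_toSubgroup]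
  constructor
  · rintro (⟨i', e, hi⟩ | ⟨i', e, j, hj, hi⟩)
    · exact absurd e (h.mul_zpow_ne _ _)
    · have := dvd_add (hd.trans (h.zpow_eq_zpow_iff.1 (mul_left_cancel e))) hi
      exact ⟨j, hj, by simpa using this⟩
  · exact fun hi => Or.inr ⟨i, rfl, hi⟩

theorem card_subgroup (h : IsExt x y k m) : Nat.card (Subgroup G) = (codes k m).card := by
  rw [← Nat.card_eq_finsetCard]
  symm
  refine Nat.card_eq_of_bijective (fun c : codes k m =>
    h.toSubgroup c.1.1 c.1.2 fun j hj => (forall_of_mem_codes c.2 j hj).2) ⟨?_, ?_⟩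
  · rintro ⟨⟨d, o⟩, hc⟩ ⟨⟨d', o'⟩, hc'⟩ e
    have hd := dvd_of_mem_codes hc
    have hd' := dvd_of_mem_codes hc'
    have hx (i : ℤ) : (d : ℤ) ∣ i ↔ (d' : ℤ) ∣ i := by
      rw [← h.zpow_mem_toSubgroup hd, ← h.zpow_mem_toSubgroup hd']
      exact SetLike.ext_iff.1 e _
    have hy (i : ℤ) : (∃ j ∈ o, (d : ℤ) ∣ i - j) ↔ ∃ j ∈ o', (d' : ℤ) ∣ i - j := by
      rw [← h.mul_zpow_mem_toSubgroup hd, ← h.mul_zpow_mem_toSubgroup hd']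
      exact SetLike.ext_iff.1 e _
    obtain rfl : d = d' := Nat.dvd_antisymm
      (Int.natCast_dvd_natCast.1 ((hx _).2 dvd_rfl)) (Int.natCast_dvd_natCast.1 ((hx _).1 dvd_rfl))
    have huniq {a b : ℕ} (ha : a < d) (hb : b < d) (hab : (d : ℤ) ∣ (a : ℤ) - b) : a = b :=
      (Nat.ModEq.eq_of_lt_of_lt ((Nat.modEq_iff_dvd.2 hab)) hb ha).symm
    have ho : o = o' := by
      ext a
      constructor
      · intro ha
        obtain ⟨b, hb, hab⟩ := (hy a).1 ⟨a, ha, by simp⟩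
        rwa [huniq (forall_of_mem_codes hc a ha).1 (forall_of_mem_codes hc' b hb).1 hab]
      · intro ha
        obtain ⟨b, hb, hab⟩ := (hy a).2 ⟨a, ha, by simp⟩
        rwa [huniq (forall_of_mem_codes hc' a ha).1 (forall_of_mem_codes hc b hb).1 hab]
    rw [Subtype.mk.injEq, ho]
  · intro H
    obtain ⟨d, hd⟩ : ∃ d : ℕ, ∀ i : ℤ, x ^ i ∈ H ↔ (d : ℤ) ∣ i := by
      obtain ⟨a, ha⟩ := Int.subgroup_cyclic (Subgroup.toAddSubgroup H |>.comap
        (zmultiplesHom (Additive G) (Additive.ofMul x)))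
      refine ⟨a.natAbs, fun i => ?_⟩
      rw [Int.natAbs_dvd, ← Int.mem_zmultiples_iff, AddSubgroup.zmultiples_eq_closure, ← ha]
      rfl
    have hd8 : d ∣ 8 := by
      rw [← Int.natCast_dvd_natCast, ← hd, h.zpow_eq_one_iff.2 (by norm_num)]
      exact H.one_mem
    have hdvd : (d : ℤ) ∣ 8 := by exact_mod_cast hd8
    obtain ⟨o, ho, hoH⟩ : ∃ o : Option ℕ, (∀ j ∈ o, j < d ∧ (d : ℤ) ∣ m + (k + 1) * j) ∧
        ∀ i : ℤ, y * x ^ i ∈ H ↔ ∃ j ∈ o, (d : ℤ) ∣ i - j := by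
      by_cases hex : ∃ j : ℤ, y * x ^ j ∈ H
      · obtain ⟨j, hj⟩ := hex
        have hmem (i : ℤ) : y * x ^ i ∈ H ↔ (d : ℤ) ∣ i - j := by
          rw [← hd, ← H.mul_mem_cancel_left (y := x ^ (i - j)) hj, mul_assoc, ← zpow_add,
            add_sub_cancel]
        have hpos : (0 : ℤ) < d := by exact_mod_cast Nat.pos_of_dvd_of_pos hd8 (by norm_num)
        obtain ⟨a, ha⟩ := Int.eq_ofNat_of_zero_le (Int.emod_nonneg j hpos.ne')
        have haj : (d : ℤ) ∣ j - a := by rw [← ha]; exact Int.dvd_self_sub_emod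
        have haH : y * x ^ (a : ℤ) ∈ H := (hmem a).2 (by rw [← dvd_neg, neg_sub]; exact haj)
        refine ⟨some a, ?_, fun i => ?_⟩
        · rintro _ ⟨⟩
          refine ⟨by exact_mod_cast ha ▸ Int.emod_lt_of_pos j hpos, ?_⟩
          have := H.mul_mem haH haH
          rw [h.mul_mul_mul, hd] at this
          ring_nf at this ⊢
          exact this
        · simp only [Option.mem_some_iff, exists_eq_left', hmem]
          rw [← dvd_add_left haj, sub_add_sub_cancel]
      · push Not at hex
        exact ⟨none, by simp, fun i => by simpa using hex i⟩
    refine ⟨⟨(d, o), mem_codes hd8 ho⟩, ?_⟩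
    ext g
    obtain ⟨i, rfl | rfl⟩ := h.cover g
    · rw [h.zpow_mem_toSubgroup hdvd, hd]
    · rw [h.mul_zpow_mem_toSubgroup hdvd, hoH]

end IsExt

end CyclicExtension

theorem isExt_zmod_two_prod_zmod_eight :
    IsExt (G := Multiplicative (ZMod 2) × Multiplicative (ZMod 8))
      (1, Multiplicative.ofAdd 1) (Multiplicative.ofAdd 1, 1) 1 0 where
  conj := by decide
  sq := by decide
  order := by
    rw [Prod.orderOf_mk, orderOf_ofAdd_eq_addOrderOf, ZMod.addOrderOf_one]; simp
  notMem i e := by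
    have := congrArg Prod.fst e
    rw [Prod.pow_fst, one_zpow] at this
    exact absurd this (by decide)
  cover := by
    have key : ∀ g : Multiplicative (ZMod 2) × Multiplicative (ZMod 8), ∃ i : Fin 8,
        g = (1, Multiplicative.ofAdd 1) ^ (i : ℕ) ∨
        g = (Multiplicative.ofAdd 1, 1) * (1, Multiplicative.ofAdd 1) ^ (i : ℕ) := by decide
    intro g
    obtain ⟨i, hi⟩ := key g
    exact ⟨(i : ℕ), by simpa only [zpow_natCast] using hi⟩

theorem isExt_quaternionGroup_four :
    IsExt (G := QuaternionGroup 4) (.a 1) (.xa 0) 7 4 where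
  conj := by decide
  sq := by decide
  order := QuaternionGroup.orderOf_a_one
  notMem i e := by
    have h1 : (QuaternionGroup.xa 0 : QuaternionGroup 4) ∈
        Subgroup.zpowers (QuaternionGroup.a 1 : QuaternionGroup 4) := ⟨i, e.symm⟩
    rw [← mem_powers_iff_mem_zpowers] at h1
    obtain ⟨n, hn⟩ := h1
    simp [QuaternionGroup.a_one_pow] at hn
  cover
    | .a i => ⟨i.val, Or.inl (by
        rw [zpow_natCast, QuaternionGroup.a_one_pow, ZMod.natCast_zmod_val])⟩
    | .xa i => ⟨i.val, Or.inr (by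
        rw [zpow_natCast, QuaternionGroup.a_one_pow, ZMod.natCast_zmod_val,
          QuaternionGroup.xa_mul_a, zero_add])⟩

/-- The affine action of `M(16)` on `ZMod 8`, where `x` acts as `t ↦ t + 1` and `y` as
`t ↦ 5 * t`. -/
def modularGens : Fin 2 → Equiv.Perm (ZMod 8) :=
  ![Equiv.addRight 1, ⟨fun t => 5 * t, fun t => 5 * t, by decide, by decide⟩]

theorem lift_modularGens_eq_one :
    ∀ r ∈ modularRels 2 4, FreeGroup.lift modularGens r = 1 := by
  rintro r (rfl | rfl | rfl) <;>
    simp only [map_pow, map_mul, map_inv, FreeGroup.lift_apply_of] <;> decide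

theorem exists_isExt_modularGroup : ∃ x y : ModularGroup 2 4, IsExt x y 5 0 := by
  let x : ModularGroup 2 4 := PresentedGroup.of (rels := modularRels 2 4) 0
  let y : ModularGroup 2 4 := PresentedGroup.of (rels := modularRels 2 4) 1
  let φ : ModularGroup 2 4 →* Equiv.Perm (ZMod 8) :=
    PresentedGroup.toGroup lift_modularGens_eq_one
  have hx : φ x = modularGens 0 := PresentedGroup.toGroup.of _
  have hy : φ y = modularGens 1 := PresentedGroup.toGroup.of _
  have hx8 : x ^ 8 = 1 :=
    PresentedGroup.one_of_mem (rels := modularRels 2 4) (Or.inl rfl)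
  have hrel : ExtRel x y 5 0 :=
    { conj := mul_inv_eq_one.1
        (PresentedGroup.one_of_mem (rels := modularRels 2 4) (Or.inr (Or.inr rfl)))
      sq := (pow_two y).symm.trans
        (PresentedGroup.one_of_mem (rels := modularRels 2 4) (Or.inr (Or.inl rfl))) }
  refine ⟨x, y, { toExtRel := hrel, order := ?_, notMem := ?_, cover := ?_ }⟩
  · refine orderOf_eq_prime_pow (p := 2) (n := 2) (fun h => ?_) hx8
    have := congrArg φ h
    rw [map_pow, hx, map_one] at this
    exact absurd this (by decide)
  · intro i h
    have h1 : y ∈ Submonoid.powers x := by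
      rw [(isOfFinOrder_iff_pow_eq_one.2 ⟨8, by norm_num, hx8⟩).mem_powers_iff_mem_zpowers]
      exact ⟨i, h.symm⟩
    obtain ⟨n, hn⟩ := h1
    have h2 : modularGens 0 ^ n = modularGens 1 := by
      rw [← hx, ← hy, ← map_pow]
      exact congrArg φ hn
    have h3 : Commute (modularGens 0) (modularGens 1) := h2 ▸ (Commute.refl _).pow_right n
    exact absurd h3.eq (by decide)
  · intro g
    have htop : hrel.span = ⊤ := by
      rw [eq_top_iff]
      refine (PresentedGroup.closure_range_of (modularRels 2 4)).symm.le.trans ?_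
      refine (Subgroup.closure_le (G := ModularGroup 2 4) hrel.span).2 ?_
      rintro _ ⟨i, rfl⟩
      fin_cases i
      · exact ExtRel.mem_span.2 ⟨1, Or.inl (zpow_one x).symm⟩
      · exact ExtRel.mem_span.2 ⟨0, Or.inr (by rw [zpow_zero, mul_one]; rfl)⟩
    exact ExtRel.mem_span.1 (htop ▸ Subgroup.mem_top g)

section OrderSixteen

variable {G : Type*} [Group G]

/-- A noncyclic group of order `16` with an element of order `8` is one of five extensions. -/
theorem exists_isExt_of_orderOf_eq_eight (hcard : Nat.card G = 16) (hnc : ¬ IsCyclic G) {x : G}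
    (hx : orderOf x = 8) :
    ∃ (y : G) (k m : ℤ), IsExt x y k m ∧
      (k, m) ∈ ({(1, 0), (7, 4), (5, 0), (3, 0), (7, 0)} : Set (ℤ × ℤ)) := by
  have hindex : (Subgroup.zpowers x).index = 2 := by
    have := (Subgroup.zpowers x).card_mul_index
    rw [Nat.card_zpowers, hx, hcard] at this
    lia
  have hnormal := Subgroup.normal_of_index_eq_two hindex
  obtain ⟨y, hy⟩ : ∃ y, y ∉ Subgroup.zpowers x := by
    by_contra! hall
    exact hnc ⟨x, hall⟩
  obtain ⟨k, hk⟩ : y⁻¹ * x * y ∈ Subgroup.zpowers x := by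
    simpa using hnormal.conj_mem x (Subgroup.mem_zpowers x) y⁻¹
  obtain ⟨m, hm⟩ : y * y ∈ Subgroup.zpowers x := Subgroup.mul_self_mem_of_index_two hindex y
  have h : IsExt x y k m :=
    { conj := hk.symm
      sq := hm.symm
      order := hx
      notMem := fun i e => hy ⟨i, e.symm⟩
      cover := fun g => by
        by_cases hg : g ∈ Subgroup.zpowers x
        · obtain ⟨i, rfl⟩ := hg
          exact ⟨i, Or.inl rfl⟩
        · have : y⁻¹ * g ∈ Subgroup.zpowers x := by
            rw [Subgroup.mul_mem_iff_of_index_two hindex, inv_mem_iff]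
            exact iff_of_false hy hg
          obtain ⟨i, hi⟩ := this
          exact ⟨i, Or.inr (by rw [← inv_mul_eq_iff_eq_mul]; exact hi.symm)⟩ }
  have hkodd : ¬ (2 : ℤ) ∣ k := by
    intro h2
    have h4 : x ^ (4 : ℤ) * y = y * x ^ (k * 4) := h.zpow_mul 4
    rw [h.zpow_eq_one_iff.2 (by lia : (8 : ℤ) ∣ k * 4), mul_one, mul_eq_right,
      h.zpow_eq_one_iff] at h4
    lia
  have hkm : 8 ∣ m - k * m := by
    have h1 : x ^ m * y = y * x ^ (k * m) := h.zpow_mul m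
    rw [← h.zpow_eq_zpow_iff, ← mul_left_cancel_iff (a := y), ← h1, ← h.sq, mul_assoc]
  have hk8 : k % 8 = 1 ∨ k % 8 = 3 ∨ k % 8 = 5 ∨ k % 8 = 7 := by lia
  have hred := h.congr (k' := k % 8) (m' := m) Int.dvd_self_sub_emod (by simp)
  replace hkm : 8 ∣ m - k % 8 * m := by
    have := dvd_add hkm ((Int.dvd_self_sub_emod (x := k) (m := 8)).mul_right m)
    ring_nf at this ⊢
    exact this
  clear h hk hkodd
  rcases hk8 with e | e | e | e <;> rw [e] at hred hkm
  · have hmeven : (2 : ℤ) ∣ m := by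
      by_contra hodd
      have hmm : 8 ∣ 1 - m * m := by
        have : m % 8 = 1 ∨ m % 8 = 3 ∨ m % 8 = 5 ∨ m % 8 = 7 := by lia
        apply Int.dvd_of_emod_eq_zero
        rcases this with e | e | e | e <;> simp [Int.sub_emod, Int.mul_emod, e]
      have hxy : x ∈ Subgroup.zpowers y := by
        have h1 : x ^ (1 : ℤ) = x ^ (m * m) := hred.zpow_eq_zpow_iff.2 hmm
        rw [zpow_one, zpow_mul, ← hred.sq] at h1
        rw [h1]
        exact zpow_mem (mul_mem (Subgroup.mem_zpowers y) (Subgroup.mem_zpowers y)) m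
      refine hnc ⟨y, fun g => ?_⟩
      obtain ⟨i, rfl | rfl⟩ := hred.cover g
      · exact zpow_mem hxy i
      · exact mul_mem (Subgroup.mem_zpowers y) (zpow_mem hxy i)
    obtain ⟨a, rfl⟩ := hmeven
    exact ⟨_, 1, 0, hred.mul_right (-a) (by ring_nf; simp), by simp⟩
  · obtain ⟨a, rfl⟩ : (4 : ℤ) ∣ m := by lia
    exact ⟨_, 3, 0, hred.mul_right (-a) (by ring_nf; simp), by simp⟩
  · obtain ⟨a, rfl⟩ : (2 : ℤ) ∣ m := by lia
    exact ⟨_, 5, 0, hred.mul_right a (by lia), by simp⟩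
  · have hm8 : 8 ∣ m - 0 ∨ 8 ∣ m - 4 := by lia
    rcases hm8 with hm8 | hm8
    · exact ⟨y, 7, 0, hred.congr (by simp) hm8, by simp⟩
    · exact ⟨y, 7, 4, hred.congr (by simp) hm8, by simp⟩

variable [Finite G]

theorem eq_or_eq_inv_of_zpowers_eq_s5 {a b : G} (ha : a ≠ 1) (hb : orderOf b ≤ 4)
    (hab : Subgroup.zpowers a = Subgroup.zpowers b) : a = b ∨ a = b⁻¹ := by
  classical
  have hord : orderOf a = orderOf b := by rw [← Nat.card_zpowers, hab, Nat.card_zpowers]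
  have hmem : a ∈ Subgroup.zpowers b := hab ▸ Subgroup.mem_zpowers a
  rw [← mem_powers_iff_mem_zpowers, mem_powers_iff_mem_range_orderOf, Finset.mem_image] at hmem
  obtain ⟨n, hn, rfl⟩ := hmem
  rw [Finset.mem_range] at hn
  have hpow := pow_orderOf_eq_one b
  obtain rfl | rfl | hlast : n = 0 ∨ n = 1 ∨ 2 ≤ n := by lia
  · simp at ha
  · simp
  · obtain e | ⟨e, rfl⟩ : orderOf b = n + 1 ∨ orderOf b = 4 ∧ n = 2 := by lia
    · right
      rw [e, pow_succ] at hpow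
      exact eq_inv_of_mul_eq_one_left hpow
    · have : orderOf (b ^ 2) ≤ 2 := orderOf_le_of_pow_eq_one (by norm_num) (by
        rw [← pow_mul, ← hpow, e])
      lia

/-- A group of order `16` without elements of order `8` has at least `9` cyclic subgroups and at
least `3` subgroups of order at least `8`. -/
theorem eleven_lt_card_subgroup (hcard : Nat.card G = 16) (hord : ∀ g : G, orderOf g ≤ 4) :
    11 < Nat.card (Subgroup G) := by
  classical
  have := Fintype.ofFinite G
  have := Fintype.ofFinite (Subgroup G)
  have hp : Fact (Nat.Prime 2) := ⟨Nat.prime_two⟩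
  obtain ⟨M, hM⟩ := Sylow.exists_subgroup_card_pow_prime (G := G) 2 (n := 3)
    (by rw [hcard]; norm_num)
  obtain ⟨g, hg⟩ : ∃ g, g ∉ M := by
    by_contra! hall
    rw [(Subgroup.eq_top_iff' M).2 hall, Subgroup.card_top, hcard] at hM
    norm_num at hM
  have hgdvd : orderOf g ∣ 2 ^ 4 := (orderOf_dvd_natCard g).trans hcard.dvd
  obtain ⟨n, hn, hgn⟩ := (Nat.dvd_prime_pow Nat.prime_two).1 hgdvd
  have hn3 : n ≤ 3 := by
    by_contra! hlt
    have := hord g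
    have := Nat.pow_le_pow_right (n := 2) (by norm_num) hlt
    lia
  obtain ⟨N, hN, hgN⟩ := Sylow.exists_subgroup_card_pow_prime_le (G := G) 2 (n := n) (m := 3)
    (by rw [hcard]; norm_num) (Subgroup.zpowers g) (by rw [Nat.card_zpowers, hgn]) hn3
  have hNM : N ≠ M := fun e => hg (e ▸ hgN (Subgroup.mem_zpowers g))
  let A : Finset G := Finset.univ.erase 1
  have hA : A.card = 15 := by
    rw [Finset.card_erase_of_mem (Finset.mem_univ _), Finset.card_univ, ← Nat.card_eq_fintype_card,
      hcard]
  let S : Finset (Subgroup G) := A.image Subgroup.zpowers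
  have hS : 8 ≤ S.card := by
    have : A.card ≤ 2 * S.card := by
      refine Finset.card_le_mul_card_image A 2 fun H hH => ?_
      obtain ⟨b, -, rfl⟩ := Finset.mem_image.1 hH
      refine (Finset.card_le_card (t := {b, b⁻¹}) fun a ha => ?_).trans Finset.card_le_two
      obtain ⟨ha1, hab⟩ := Finset.mem_filter.1 ha
      simpa using eq_or_eq_inv_of_zpowers_eq_s5 (Finset.ne_of_mem_erase ha1) (hord b) hab
    lia
  have hScard : ∀ H ∈ S, Nat.card H ≤ 4 ∧ Nat.card H ≠ 1 := by
    intro H hH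
    obtain ⟨b, hb, rfl⟩ := Finset.mem_image.1 hH
    rw [Nat.card_zpowers, Ne, orderOf_eq_one_iff]
    exact ⟨hord b, Finset.ne_of_mem_erase hb⟩
  let T : Finset (Subgroup G) := {⊥, ⊤, M, N}
  have hbot : Nat.card (⊥ : Subgroup G) = 1 := Subgroup.card_bot
  have htop : Nat.card (⊤ : Subgroup G) = 16 := by rw [Subgroup.card_top, hcard]
  have hne {H K : Subgroup G} (h : Nat.card H ≠ Nat.card K) : H ≠ K := fun e => h (e ▸ rfl)
  have hT : T.card = 4 := by
    have h1 : (⊥ : Subgroup G) ≠ ⊤ := hne (by lia)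
    have h2 : ⊥ ≠ M := hne (by lia)
    have h3 : ⊥ ≠ N := hne (by lia)
    have h4 : ⊤ ≠ M := hne (by lia)
    have h5 : ⊤ ≠ N := hne (by lia)
    rw [Finset.card_insert_of_notMem, Finset.card_insert_of_notMem, Finset.card_pair hNM.symm]
    · simp [h4, h5]
    · simp [h1, h2, h3]
  have hdisj : Disjoint S T := by
    rw [Finset.disjoint_left]
    intro H hH hHT
    have := hScard H hH
    simp only [T, Finset.mem_insert, Finset.mem_singleton] at hHT
    rcases hHT with rfl | rfl | rfl | rfl <;> lia
  have hle := Finset.card_le_univ (S ∪ T)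
  rw [Finset.card_union_of_disjoint hdisj, ← Nat.card_eq_fintype_card] at hle
  lia

end OrderSixteen

theorem MulEquiv.beta_eq {G K : Type*} [Group G] [Group K] (e : G ≃* K) : beta G = beta K := by
  rw [beta, beta, Nat.card_congr e.toEquiv, Nat.card_congr e.mapSubgroup.toEquiv]

theorem beta_eq_iff_card_subgroup_eq {G : Type*} [Group G] (hcard : Nat.card G = 16) :
    beta G = 11 / 16 ↔ Nat.card (Subgroup G) = 11 := by
  rw [beta, hcard, Nat.cast_ofNat, div_left_inj' (by norm_num)]
  exact_mod_cast Iff.rfl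

theorem stmt_5 (G : Type) [Group G] [Finite G]
    (hcard : Nat.card G = 16) (hnc : ¬ IsCyclic G) :
    beta (Multiplicative (ZMod 2) × Multiplicative (ZMod 8)) = 11 / 16 ∧
    beta (QuaternionGroup 4) = 11 / 16 ∧
    beta (ModularGroup 2 4) = 11 / 16 ∧
    beta G ≥ 11 / 16 ∧
    (beta G = 11 / 16 ↔
      (Nonempty (G ≃* Multiplicative (ZMod 2) × Multiplicative (ZMod 8)) ∨
       Nonempty (G ≃* QuaternionGroup 4) ∨
       Nonempty (G ≃* ModularGroup 2 4))) := by
  obtain ⟨xM, yM, hM⟩ := exists_isExt_modularGroup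
  have hZ := isExt_zmod_two_prod_zmod_eight
  have hQ := isExt_quaternionGroup_four
  have hβZ := (beta_eq_iff_card_subgroup_eq hZ.card_eq).2 (hZ.card_subgroup.trans (by decide))
  have hβQ := (beta_eq_iff_card_subgroup_eq hQ.card_eq).2 (hQ.card_subgroup.trans (by decide))
  have hβM := (beta_eq_iff_card_subgroup_eq hM.card_eq).2 (hM.card_subgroup.trans (by decide))
  refine ⟨hβZ, hβQ, hβM, ?_⟩
  have key : (Nonempty (G ≃* Multiplicative (ZMod 2) × Multiplicative (ZMod 8)) ∨
      Nonempty (G ≃* QuaternionGroup 4) ∨ Nonempty (G ≃* ModularGroup 2 4)) ∨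
      11 < Nat.card (Subgroup G) := by
    by_cases hex : ∃ x : G, orderOf x = 8
    · obtain ⟨x, hx⟩ := hex
      obtain ⟨y, k, m, h, hkm⟩ := exists_isExt_of_orderOf_eq_eight hcard hnc hx
      simp only [Set.mem_insert_iff, Set.mem_singleton_iff, Prod.mk.injEq] at hkm
      rcases hkm with ⟨rfl, rfl⟩ | ⟨rfl, rfl⟩ | ⟨rfl, rfl⟩ | ⟨rfl, rfl⟩ | ⟨rfl, rfl⟩
      · exact Or.inl (Or.inl (h.nonempty_mulEquiv hZ))
      · exact Or.inl (Or.inr (Or.inl (h.nonempty_mulEquiv hQ)))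
      · exact Or.inl (Or.inr (Or.inr (h.nonempty_mulEquiv hM)))
      · exact Or.inr (h.card_subgroup ▸ by decide)
      · exact Or.inr (h.card_subgroup ▸ by decide)
    · refine Or.inr (eleven_lt_card_subgroup hcard fun g => ?_)
      have hdvd : orderOf g ∣ 2 ^ 4 := (orderOf_dvd_natCard g).trans hcard.dvd
      obtain ⟨n, hn, hgn⟩ := (Nat.dvd_prime_pow Nat.prime_two).1 hdvd
      have h16 : orderOf g ≠ 16 := fun e => hnc (isCyclic_of_orderOf_eq_card g (e.trans hcard.symm))
      have h8 : orderOf g ≠ 8 := fun e => hex ⟨g, e⟩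
      interval_cases n <;> lia
  have hiso (h : Nonempty (G ≃* Multiplicative (ZMod 2) × Multiplicative (ZMod 8)) ∨
      Nonempty (G ≃* QuaternionGroup 4) ∨ Nonempty (G ≃* ModularGroup 2 4)) :
      beta G = 11 / 16 := by
    rcases h with ⟨⟨e⟩⟩ | ⟨⟨e⟩⟩ | ⟨⟨e⟩⟩
    · rw [e.beta_eq, hβZ]
    · rw [e.beta_eq, hβQ]
    · rw [e.beta_eq, hβM]
  refine ⟨?_, fun h => key.resolve_right ?_, hiso⟩
  · rcases key with h | h
    · exact (hiso h).ge
    · rw [beta, hcard, Nat.cast_ofNat]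
      have : (11 : ℝ) ≤ Nat.card (Subgroup G) := by exact_mod_cast h.le
      gcongr
  · rw [(beta_eq_iff_card_subgroup_eq hcard).1 h]
    exact lt_irrefl _
end

section
/- For every integer n ≥ 3, the number of subgroups of the generalized quaternion group Q_{2^n} equals 2^{n-1} + n - 1; consequently β(Q_{2^n}) = (2^{n-1} + n - 1)/2^n, and for every integer n ≥ 4 one has β(Q_{2^n}) ≥ (3(n-1)+2)/2^n, with equality exactly when n = 4. -/
open scoped ArithmeticFunction.sigma

namespace ZMod

variable {N : ℕ}

/-- A subgroup of `ZMod N` consists of the multiples of its index. -/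
theorem intCast_mem_addSubgroup_iff (K : AddSubgroup (ZMod N)) (k : ℤ) :
    (k : ZMod N) ∈ K ↔ (K.index : ℤ) ∣ k := by
  obtain ⟨g, hg⟩ := Int.subgroup_cyclic (K.comap (Int.castAddHom (ZMod N)))
  rw [← AddSubgroup.zmultiples_eq_closure] at hg
  have hindex : K.index = g.natAbs := by
    rw [← Int.index_zmultiples, ← hg,
      AddSubgroup.index_comap_of_surjective _ ZMod.intCast_surjective]
  rw [hindex, Int.natAbs_dvd, ← Int.mem_zmultiples_iff, ← hg]
  rfl

theorem natCast_mem_addSubgroup_iff (K : AddSubgroup (ZMod N)) (k : ℕ) :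
    (k : ZMod N) ∈ K ↔ K.index ∣ k := by
  rw [← Int.natCast_dvd_natCast, ← intCast_mem_addSubgroup_iff, Int.cast_natCast]

theorem addSubgroup_index_dvd (K : AddSubgroup (ZMod N)) : K.index ∣ N := by
  rw [← natCast_mem_addSubgroup_iff, ZMod.natCast_self]
  exact K.zero_mem

theorem addSubgroup_index_injective :
    Function.Injective (AddSubgroup.index : AddSubgroup (ZMod N) → ℕ) := by
  intro K L h
  ext x
  obtain ⟨k, rfl⟩ := ZMod.intCast_surjective x
  rw [intCast_mem_addSubgroup_iff, intCast_mem_addSubgroup_iff, h]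

theorem index_zmultiples_natCast {d : ℕ} (hd : d ∣ N) :
    (AddSubgroup.zmultiples (d : ZMod N)).index = d := by
  apply Nat.dvd_antisymm
  · rw [← natCast_mem_addSubgroup_iff]
    exact AddSubgroup.mem_zmultiples _
  · obtain ⟨k, hk⟩ := AddSubgroup.mem_zmultiples_iff.mp
      ((natCast_mem_addSubgroup_iff (AddSubgroup.zmultiples (d : ZMod N)) _).mpr dvd_rfl)
    generalize (AddSubgroup.zmultiples (d : ZMod N)).index = e at hk
    have h : ((k * d : ℤ) : ZMod N) = ((e : ℤ) : ZMod N) := by simpa using hk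
    rw [ZMod.intCast_eq_intCast_iff_dvd_sub] at h
    have := (dvd_sub_left (dvd_mul_left (d : ℤ) k)).mp ((Int.natCast_dvd_natCast.mpr hd).trans h)
    exact Int.natCast_dvd_natCast.mp this

/-- The subgroups of `ZMod N` correspond to the divisors of `N` via the index. -/
noncomputable def addSubgroupEquivDivisors [NeZero N] : AddSubgroup (ZMod N) ≃ N.divisors where
  toFun K := ⟨K.index, Nat.mem_divisors.mpr ⟨addSubgroup_index_dvd K, NeZero.ne N⟩⟩
  invFun d := AddSubgroup.zmultiples ((d : ℕ) : ZMod N)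
  left_inv K := addSubgroup_index_injective (index_zmultiples_natCast (addSubgroup_index_dvd K))
  right_inv d := Subtype.ext (index_zmultiples_natCast (Nat.dvd_of_mem_divisors d.2))

theorem natCard_addSubgroup [NeZero N] : Nat.card (AddSubgroup (ZMod N)) = σ 0 N := by
  rw [Nat.card_congr addSubgroupEquivDivisors, ArithmeticFunction.sigma_zero_apply,
    Nat.card_eq_fintype_card, Fintype.card_coe]

/-- The subgroups of `ZMod N` containing a divisor `m` of `N` correspond to the divisors of `m`
via the index. -/
noncomputable def addSubgroupMemEquivDivisors {m : ℕ} [NeZero m] (hm : m ∣ N) :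
    {K : AddSubgroup (ZMod N) // (m : ZMod N) ∈ K} ≃ m.divisors where
  toFun K := ⟨K.1.index,
    Nat.mem_divisors.mpr ⟨(natCast_mem_addSubgroup_iff K.1 m).mp K.2, NeZero.ne m⟩⟩
  invFun d := ⟨AddSubgroup.zmultiples ((d : ℕ) : ZMod N), by
    have hd := Nat.dvd_of_mem_divisors d.2
    rwa [natCast_mem_addSubgroup_iff, index_zmultiples_natCast (hd.trans hm)]⟩
  left_inv K := Subtype.ext <| addSubgroup_index_injective <|
    index_zmultiples_natCast (addSubgroup_index_dvd K.1)
  right_inv d := Subtype.ext <|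
    index_zmultiples_natCast ((Nat.dvd_of_mem_divisors d.2).trans hm)

theorem natCard_sigma_quotient_addSubgroup {m : ℕ} [NeZero m] [NeZero N] (hm : m ∣ N) :
    Nat.card (Σ K : {K : AddSubgroup (ZMod N) // (m : ZMod N) ∈ K}, ZMod N ⧸ K.1) = σ 1 m := by
  have := Fintype.ofFinite {K : AddSubgroup (ZMod N) // (m : ZMod N) ∈ K}
  rw [Nat.card_sigma, ArithmeticFunction.sigma_one_apply, ← Finset.sum_coe_sort m.divisors fun d ↦ d]
  exact Fintype.sum_equiv (addSubgroupMemEquivDivisors hm) _ _ fun _ ↦ rfl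

end ZMod

namespace QuaternionGroup

variable {m : ℕ}

theorem inv_xa (i : ZMod (2 * m)) : (xa i)⁻¹ = xa ((m : ZMod (2 * m)) + i) := rfl

/-- The subgroup of those `a i` with `i` in a given subgroup of `ZMod (2 * m)`. -/
def rotationSubgroup (K : AddSubgroup (ZMod (2 * m))) : Subgroup (QuaternionGroup m) where
  carrier := {g | match g with
    | a i => i ∈ K
    | xa _ => False}
  one_mem' := K.zero_mem
  mul_mem' := by
    rintro (i | i) (j | j) hi hj
    · exact K.add_mem hi hj
    · exact hj
    · exact hi
    · exact hi.elim
  inv_mem' := by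
    rintro (i | i) hi
    · exact K.neg_mem hi
    · exact hi

theorem a_mem_rotationSubgroup {K : AddSubgroup (ZMod (2 * m))} {i : ZMod (2 * m)} :
    a i ∈ rotationSubgroup K ↔ i ∈ K := Iff.rfl

theorem xa_notMem_rotationSubgroup {K : AddSubgroup (ZMod (2 * m))} {i : ZMod (2 * m)} :
    xa i ∉ rotationSubgroup K := id

/-- The subgroup of those `a i` with `i ∈ K` and those `xa j` with `j` in a given coset of `K`. -/
def cosetSubgroup (K : AddSubgroup (ZMod (2 * m))) (hK : (m : ZMod (2 * m)) ∈ K)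
    (q : ZMod (2 * m) ⧸ K) : Subgroup (QuaternionGroup m) where
  carrier := {g | match g with
    | a i => i ∈ K
    | xa j => (j : ZMod (2 * m) ⧸ K) = q}
  one_mem' := K.zero_mem
  mul_mem' := by
    have hm := (QuotientAddGroup.eq_zero_iff (m : ZMod (2 * m))).mpr hK
    rintro (i | i) (j | j) hi hj <;>
      simp only [Set.mem_ofPred_eq, a_mul_a, a_mul_xa, xa_mul_a, xa_mul_xa,
        ← QuotientAddGroup.eq_zero_iff, QuotientAddGroup.mk_add,
        QuotientAddGroup.mk_sub] at hi hj ⊢ <;>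
      simp [hi, hj, hm]
  inv_mem' := by
    have hm := (QuotientAddGroup.eq_zero_iff (m : ZMod (2 * m))).mpr hK
    rintro (i | i) hi
    · exact K.neg_mem hi
    · simp only [Set.mem_ofPred_eq, inv_xa, QuotientAddGroup.mk_add] at hi ⊢
      simp [hi, hm]

theorem a_mem_cosetSubgroup {K : AddSubgroup (ZMod (2 * m))} {hK : (m : ZMod (2 * m)) ∈ K}
    {q : ZMod (2 * m) ⧸ K} {i : ZMod (2 * m)} : a i ∈ cosetSubgroup K hK q ↔ i ∈ K := Iff.rfl

theorem xa_mem_cosetSubgroup {K : AddSubgroup (ZMod (2 * m))} {hK : (m : ZMod (2 * m)) ∈ K}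
    {q : ZMod (2 * m) ⧸ K} {j : ZMod (2 * m)} :
    xa j ∈ cosetSubgroup K hK q ↔ (j : ZMod (2 * m) ⧸ K) = q := Iff.rfl

/-- The exponents `i` for which `a i` lies in a given subgroup. -/
def rotationExponents (H : Subgroup (QuaternionGroup m)) : AddSubgroup (ZMod (2 * m)) where
  carrier := {i | a i ∈ H}
  zero_mem' := H.one_mem
  add_mem' hi hj := H.mul_mem hi hj
  neg_mem' hi := H.inv_mem hi

theorem mem_rotationExponents {H : Subgroup (QuaternionGroup m)} {i : ZMod (2 * m)} :
    i ∈ rotationExponents H ↔ a i ∈ H := Iff.rfl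

theorem rotationExponents_rotationSubgroup (K : AddSubgroup (ZMod (2 * m))) :
    rotationExponents (rotationSubgroup K) = K := rfl

theorem rotationExponents_cosetSubgroup (K : AddSubgroup (ZMod (2 * m)))
    (hK : (m : ZMod (2 * m)) ∈ K) (q : ZMod (2 * m) ⧸ K) :
    rotationExponents (cosetSubgroup K hK q) = K := rfl

/-- All subgroups of the quaternion group, parametrised by the subgroups of `ZMod (2 * m)` and the
cosets of those containing `m`. -/
def subgroupOfSum : AddSubgroup (ZMod (2 * m)) ⊕
    (Σ K : {K : AddSubgroup (ZMod (2 * m)) // (m : ZMod (2 * m)) ∈ K}, ZMod (2 * m) ⧸ K.1) →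
      Subgroup (QuaternionGroup m) :=
  Sum.elim rotationSubgroup fun p ↦ cosetSubgroup p.1.1 p.1.2 p.2

theorem subgroupOfSum_injective : Function.Injective (subgroupOfSum (m := m)) := by
  refine Function.Injective.sumElim ?_ ?_ ?_
  · exact Function.LeftInverse.injective rotationExponents_rotationSubgroup
  · rintro ⟨⟨K, hK⟩, q⟩ ⟨⟨L, hL⟩, r⟩ h
    dsimp only at h
    obtain rfl : K = L := by
      rw [← rotationExponents_cosetSubgroup K hK q, h, rotationExponents_cosetSubgroup]
    obtain ⟨j, rfl⟩ := QuotientAddGroup.mk_surjective q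
    obtain rfl := xa_mem_cosetSubgroup.mp (h ▸ xa_mem_cosetSubgroup.mpr rfl)
    rfl
  · rintro K ⟨⟨L, hL⟩, q⟩ h
    obtain ⟨j, rfl⟩ := QuotientAddGroup.mk_surjective q
    exact xa_notMem_rotationSubgroup (h ▸ xa_mem_cosetSubgroup.mpr rfl)

theorem subgroupOfSum_surjective : Function.Surjective (subgroupOfSum (m := m)) := by
  intro H
  by_cases h : ∃ j, xa j ∈ H
  · obtain ⟨j, hj⟩ := h
    have hm : (m : ZMod (2 * m)) ∈ rotationExponents H := by
      simpa [mem_rotationExponents] using H.mul_mem hj hj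
    refine ⟨Sum.inr ⟨⟨rotationExponents H, hm⟩, j⟩, ?_⟩
    ext (i | i)
    · rfl
    · change xa i ∈ cosetSubgroup _ hm _ ↔ _
      rw [xa_mem_cosetSubgroup, eq_comm, QuotientAddGroup.eq, mem_rotationExponents,
        ← H.mul_mem_cancel_left hj, xa_mul_a, add_neg_cancel_left]
  · push Not at h
    refine ⟨Sum.inl (rotationExponents H), ?_⟩
    ext (i | i)
    · rfl
    · exact iff_of_false xa_notMem_rotationSubgroup (h i)

theorem natCard_subgroup [NeZero m] :
    Nat.card (Subgroup (QuaternionGroup m)) = σ 0 (2 * m) + σ 1 m := by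
  rw [← Nat.card_congr (Equiv.ofBijective _ ⟨subgroupOfSum_injective, subgroupOfSum_surjective⟩),
    Nat.card_sum, ZMod.natCard_addSubgroup,
    ZMod.natCard_sigma_quotient_addSubgroup (dvd_mul_left m 2)]

theorem natCard_subgroup_two_pow (k : ℕ) :
    Nat.card (Subgroup (QuaternionGroup (2 ^ k))) = 2 ^ (k + 1) + (k + 1) := by
  rw [natCard_subgroup, ← pow_succ', ArithmeticFunction.sigma_zero_apply_prime_pow Nat.prime_two,
    ArithmeticFunction.sigma_one_apply_prime_pow Nat.prime_two, Nat.geomSum_eq le_rfl]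
  have := Nat.one_le_two_pow (n := k + 1)
  omega

theorem beta_two_pow (k : ℕ) :
    beta (QuaternionGroup (2 ^ k)) = (2 ^ (k + 1) + (k + 1)) / 2 ^ (k + 2) := by
  rw [beta, natCard_subgroup_two_pow, Nat.card_eq_fintype_card, card]
  push_cast
  ring

end QuaternionGroup

theorem stmt_7 :
    (∀ n : ℕ, 3 ≤ n →
      Nat.card (Subgroup (QuaternionGroup (2 ^ (n - 2)))) = 2 ^ (n - 1) + (n - 1)) ∧
    (∀ n : ℕ, 3 ≤ n →
      beta (QuaternionGroup (2 ^ (n - 2))) = ((2 : ℝ) ^ (n - 1) + (n : ℝ) - 1) / 2 ^ n) ∧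
    (∀ n : ℕ, 4 ≤ n →
      beta (QuaternionGroup (2 ^ (n - 2))) ≥ (3 * ((n : ℝ) - 1) + 2) / 2 ^ n ∧
      (beta (QuaternionGroup (2 ^ (n - 2))) = (3 * ((n : ℝ) - 1) + 2) / 2 ^ n ↔ n = 4)) := by
  refine ⟨fun n hn ↦ ?_, fun n hn ↦ ?_, fun n hn ↦ ?_⟩
  · obtain ⟨k, rfl⟩ := Nat.exists_eq_add_of_le' (show 2 ≤ n by omega)
    exact QuaternionGroup.natCard_subgroup_two_pow k
  · obtain ⟨k, rfl⟩ := Nat.exists_eq_add_of_le' (show 2 ≤ n by omega)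
    rw [Nat.add_sub_cancel, QuaternionGroup.beta_two_pow, show k + 2 - 1 = k + 1 by omega]
    push_cast
    ring
  · obtain ⟨k, rfl⟩ := Nat.exists_eq_add_of_le' hn
    rw [show k + 4 - 2 = k + 2 by omega, QuaternionGroup.beta_two_pow]
    have hpow : (k : ℝ) + 1 ≤ 2 ^ k := by exact_mod_cast Nat.lt_two_pow_self (n := k)
    have hsplit : (2 : ℝ) ^ (k + 2 + 1) = 8 * 2 ^ k := by ring
    have hk : (0 : ℝ) ≤ k := k.cast_nonneg
    push_cast
    rw [ge_iff_le, div_le_div_iff_of_pos_right (by positivity),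
      div_left_inj' (by positivity), hsplit]
    refine ⟨by linarith, fun h ↦ ?_, fun h ↦ ?_⟩
    · have : (k : ℝ) = 0 := by linarith
      simpa using this
    · obtain rfl : k = 0 := by omega
      norm_num
end
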